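/- arXiv:1110.0939 — 5 statements merged into one kernel-verified Lean document; each statement's English description precedes it below -/
import Mathlib

section
/- For every integer n ≥ 1 and every prime p with p > 2n, the p-adic valuation of lcm(1²+1, …, n²+1) equals the p-adic valuation of ∏_{i=1}^{n}(i²+1). -/
theorem padicValNat_le_of_dvd_of_ne_zero {p a b : ℕ} [Fact p.Prime] (hb : b ≠ 0) (hab : a ∣ b) :
    padicValNat p a ≤ padicValNat p b :=
  (padicValNat_dvd_iff_le hb).1 (pow_padicValNat_dvd.trans hab)

/-- If `p` divides at most one of the nonzero values of `f` on `s`, then the least common multiple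
and the product of these values have the same `p`-adic valuation. -/
theorem padicValNat_lcm_eq_padicValNat_prod {ι : Type*} {p : ℕ} [hp : Fact p.Prime]
    (s : Finset ι) (f : ι → ℕ) (hf : ∀ i ∈ s, f i ≠ 0)
    (huniq : ∀ i ∈ s, ∀ j ∈ s, p ∣ f i → p ∣ f j → i = j) :
    padicValNat p (s.lcm f) = padicValNat p (∏ i ∈ s, f i) := by
  classical
  have hprod : ∏ i ∈ s, f i ≠ 0 := Finset.prod_ne_zero_iff.2 hf
  have hdvd : s.lcm f ∣ ∏ i ∈ s, f i := Finset.lcm_dvd fun i hi => Finset.dvd_prod_of_mem f hi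
  refine le_antisymm (padicValNat_le_of_dvd_of_ne_zero hprod hdvd) ?_
  by_cases h : ∃ i ∈ s, p ∣ f i
  · obtain ⟨i, hi, hpi⟩ := h
    have hrest : ¬ p ∣ ∏ j ∈ s.erase i, f j := by
      rw [hp.out.prime.dvd_finsetProd_iff]
      rintro ⟨j, hj, hpj⟩
      exact Finset.ne_of_mem_erase hj (huniq j (Finset.mem_of_mem_erase hj) i hi hpj hpi)
    rw [← Finset.mul_prod_erase s f hi,
      padicValNat.mul (hf i hi) fun h0 => hrest (by simp only [h0, dvd_zero]),
      padicValNat.eq_zero_of_not_dvd hrest, add_zero]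
    exact padicValNat_le_of_dvd_of_ne_zero (ne_zero_of_dvd_ne_zero hprod hdvd) (Finset.dvd_lcm hi)
  · rw [padicValNat.eq_zero_of_not_dvd]
    · exact Nat.zero_le _
    · rwa [hp.out.prime.dvd_finsetProd_iff]

/-- A prime dividing both `i ^ 2 + 1` and `j ^ 2 + 1` with `i < j` is at most `i + j`. -/
theorem Nat.Prime.le_add_of_dvd_sq_add_one {p i j : ℕ} (hp : p.Prime) (hij : i < j)
    (hi : p ∣ i ^ 2 + 1) (hj : p ∣ j ^ 2 + 1) : p ≤ i + j := by
  have h : p ∣ (j + i) * (j - i) := by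
    rw [← Nat.sq_sub_sq, ← Nat.add_sub_add_right (j ^ 2) 1]
    exact Nat.dvd_sub hj hi
  rcases hp.dvd_mul.1 h with h | h <;> have := Nat.le_of_dvd (by omega) h <;> omega

/-- For `n ≥ 1` and a prime `p > 2n`, the `p`-adic valuation of
`lcm(1²+1, …, n²+1)` equals that of `∏_{i=1}^{n}(i²+1)`. -/
theorem padicValNat_lcm_eq_padicValNat_prod_of_two_mul_lt
    (n : ℕ) (hn : 1 ≤ n) (p : ℕ) (hp : p.Prime) (hlt : 2 * n < p) :
    padicValNat p ((Finset.Icc 1 n).lcm (fun i => i ^ 2 + 1)) =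
      padicValNat p (∏ i ∈ Finset.Icc 1 n, (i ^ 2 + 1)) := by
  have : Fact p.Prime := ⟨hp⟩
  refine padicValNat_lcm_eq_padicValNat_prod _ _ (fun i _ => Nat.succ_ne_zero _) ?_
  intro i hi j hj hpi hpj
  rw [Finset.mem_Icc] at hi hj
  rcases lt_trichotomy i j with h | h | h
  · have := hp.le_add_of_dvd_sq_add_one h hpi hpj
    omega
  · exact h
  · have := hp.le_add_of_dvd_sq_add_one h hpj hpi
    omega
end

section
/- There exists a constant C > 0 such that for every prime p with p ≡ 1 (mod 4) and every integer n ≥ 2, the p-adic valuation of ∏_{i=1}^{n}(i²+1) satisfies |α_p(n) − 2n/(p−1)| ≤ C·(log n)/(log p). -/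
/-- `-1` is a square modulo every positive power of a prime `p ≡ 1 (mod 4)`. -/
lemma exists_pow_dvd_sq_add_one {p : ℕ} (hp : p.Prime) (h4 : p % 4 = 1) {k : ℕ} (hk : k ≠ 0) :
    ∃ r : ℤ, (p : ℤ) ^ k ∣ r ^ 2 + 1 := by
  have := Fact.mk hp
  obtain ⟨y, hy⟩ := ZMod.exists_sq_eq_neg_one_iff.2 (show p % 4 ≠ 3 by omega)
  obtain ⟨m, rfl⟩ := Nat.exists_eq_succ_of_ne_zero hk
  obtain ⟨r, rfl⟩ := ZMod.intCast_surjective y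
  have h1 : (p : ℤ) ∣ r ^ 2 - (-1) := by
    rw [← ZMod.intCast_eq_intCast_iff_dvd_sub]
    push_cast
    rw [hy, sq]
  have hodd : Odd (p ^ m) := (Nat.odd_iff.2 (by omega)).pow
  refine ⟨r ^ p ^ m, ?_⟩
  have h2 := dvd_sub_pow_of_dvd_sub h1 m
  rwa [hodd.neg_one_pow, sub_neg_eq_add, ← pow_mul, mul_comm, pow_mul] at h2

lemma not_dvd_two_mul_of_pow_dvd_sq_add_one {p : ℕ} (hp : p.Prime) (h2 : p ≠ 2) {k : ℕ}
    (hk : k ≠ 0) {r : ℤ} (hr : (p : ℤ) ^ k ∣ r ^ 2 + 1) : ¬ (p : ℤ) ∣ 2 * r := by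
  intro h
  have hp' := Nat.prime_iff_prime_int.1 hp
  rcases hp'.dvd_or_dvd h with h | h
  · exact h2 ((Nat.prime_dvd_prime_iff_eq hp Nat.prime_two).1 (by exact_mod_cast h))
  · have h1 : (p : ℤ) ∣ r ^ 2 + 1 := (dvd_pow_self _ hk).trans hr
    exact hp'.not_dvd_one ((dvd_add_right (h.trans (dvd_pow_self r two_ne_zero))).1 h1)

/-- The square roots of `-1` modulo an odd prime power are the two negatives of each other. -/
lemma pow_dvd_sq_add_one_iff {p : ℕ} (hp : p.Prime) (h2 : p ≠ 2) {k : ℕ} (hk : k ≠ 0) {r : ℤ}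
    (hr : (p : ℤ) ^ k ∣ r ^ 2 + 1) (i : ℤ) :
    (p : ℤ) ^ k ∣ i ^ 2 + 1 ↔ i ≡ r [ZMOD (p : ℤ) ^ k] ∨ i ≡ -r [ZMOD (p : ℤ) ^ k] := by
  have hp' := Nat.prime_iff_prime_int.1 hp
  have hfac : (p : ℤ) ^ k ∣ i ^ 2 + 1 ↔ (p : ℤ) ^ k ∣ (i - r) * (i + r) := by
    rw [← dvd_sub_left hr, show i ^ 2 + 1 - (r ^ 2 + 1) = (i - r) * (i + r) by ring]
  rw [hfac, Int.modEq_comm, Int.modEq_iff_dvd, Int.modEq_comm (a := i), Int.modEq_iff_dvd,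
    sub_neg_eq_add]
  refine ⟨fun h ↦ ?_, fun h ↦ h.elim (fun h ↦ h.mul_right _) (fun h ↦ h.mul_left _)⟩
  by_cases hd : (p : ℤ) ∣ i - r
  · refine .inl (hp'.pow_dvd_of_dvd_mul_right k (fun hd' ↦ ?_) h)
    refine not_dvd_two_mul_of_pow_dvd_sq_add_one hp h2 hk hr ?_
    rw [show 2 * r = (i + r) - (i - r) by ring]
    exact dvd_sub hd' hd
  · exact .inr (hp'.pow_dvd_of_dvd_mul_left k hd h)

open Finset in
/-- A residue class modulo `m` has `n / m + O(1)` elements in `(0, n]`. -/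
lemma abs_card_modEq_sub_le {m : ℤ} (hm : 0 < m) (n : ℕ) (v : ℤ) :
    |(#{i ∈ Ioc (0 : ℤ) n | i ≡ v [ZMOD m]} : ℝ) - n / m| ≤ 1 := by
  have h := Int.Ioc_filter_modEq_card (0 : ℤ) n hm v
  have hmq : (0 : ℚ) < m := by exact_mod_cast hm
  have hle : ⌊(((0 : ℤ) : ℚ) - v) / m⌋ ≤ ⌊(((n : ℤ) : ℚ) - v) / m⌋ := by
    gcongr
    simp
  rw [max_eq_left (sub_nonneg.2 hle)] at h
  have h1 := Int.floor_le ((((n : ℤ) : ℚ) - v) / m)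
  have h2 := Int.lt_floor_add_one ((((n : ℤ) : ℚ) - v) / m)
  have h3 := Int.floor_le ((((0 : ℤ) : ℚ) - v) / m)
  have h4 := Int.lt_floor_add_one ((((0 : ℤ) : ℚ) - v) / m)
  have hq : (#{i ∈ Ioc (0 : ℤ) n | i ≡ v [ZMOD m]} : ℚ) =
      ⌊(((n : ℤ) : ℚ) - v) / m⌋ - ⌊(((0 : ℤ) : ℚ) - v) / m⌋ := by exact_mod_cast h
  have key : |(#{i ∈ Ioc (0 : ℤ) n | i ≡ v [ZMOD m]} : ℚ) - n / m| ≤ 1 := by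
    rw [hq, abs_le]
    simp only [sub_div, Int.cast_natCast, Int.cast_zero, zero_div] at h1 h2 h3 h4 ⊢
    constructor <;> linarith
  exact_mod_cast key

open Finset in
/-- The number of `i ≤ n` with `i ^ 2 + 1` divisible by `p ^ k` is `2 n / p ^ k + O(1)`. -/
lemma abs_card_pow_dvd_sq_add_one_sub_le {p : ℕ} (hp : p.Prime) (h4 : p % 4 = 1) {k : ℕ}
    (hk : k ≠ 0) (n : ℕ) :
    |(#{i ∈ Icc 1 n | p ^ k ∣ i ^ 2 + 1} : ℝ) - 2 * n / p ^ k| ≤ 2 := by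
  obtain ⟨r, hr⟩ := exists_pow_dvd_sq_add_one hp h4 hk
  have h2 : p ≠ 2 := by rintro rfl; omega
  have hpos : (0 : ℤ) < (p : ℤ) ^ k := pow_pos (by exact_mod_cast hp.pos) k
  have hcard : #{i ∈ Icc 1 n | p ^ k ∣ i ^ 2 + 1} =
      #{i ∈ Ioc (0 : ℤ) n | i ≡ r [ZMOD (p : ℤ) ^ k]} +
        #{i ∈ Ioc (0 : ℤ) n | i ≡ -r [ZMOD (p : ℤ) ^ k]} := by
    rw [← card_union_of_disjoint, ← filter_or]
    · refine card_bij (fun i _ ↦ (i : ℤ)) ?_ ?_ ?_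
      · intro i hi
        simp only [mem_filter, mem_Icc, mem_Ioc] at hi ⊢
        refine ⟨by omega, (pow_dvd_sq_add_one_iff hp h2 hk hr i).1 ?_⟩
        exact_mod_cast hi.2
      · intro i _ j _ h
        exact_mod_cast h
      · intro i hi
        simp only [mem_filter, mem_Ioc] at hi
        obtain ⟨⟨hi0, hin⟩, hi⟩ := hi
        lift i to ℕ using hi0.le
        refine ⟨i, ?_, rfl⟩
        simp only [mem_filter, mem_Icc]
        refine ⟨by omega, ?_⟩
        exact_mod_cast (pow_dvd_sq_add_one_iff hp h2 hk hr i).2 hi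
    · rw [disjoint_filter]
      intro i _ h h'
      refine not_dvd_two_mul_of_pow_dvd_sq_add_one hp h2 hk hr
        ((dvd_pow_self _ hk).trans ?_)
      have := (h'.symm.trans h).dvd
      rwa [sub_neg_eq_add, ← two_mul] at this
  have ha := abs_le.1 (abs_card_modEq_sub_le hpos n r)
  have hb := abs_le.1 (abs_card_modEq_sub_le hpos n (-r))
  rw [hcard, abs_le, mul_div_assoc]
  push_cast at *
  constructor <;> linarith [ha.1, ha.2, hb.1, hb.2]

open Finset in
/-- Legendre-type formula for the valuation of `∏ (i ^ 2 + 1)`. -/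
lemma padicValNat_prod_sq_add_one_eq_sum {p : ℕ} (hp : p.Prime) {n K : ℕ}
    (hK : n ^ 2 + 1 < p ^ (K + 1)) :
    padicValNat p (∏ i ∈ Icc 1 n, (i ^ 2 + 1)) =
      ∑ k ∈ Icc 1 K, #{i ∈ Icc 1 n | p ^ k ∣ i ^ 2 + 1} := by
  rw [← Nat.factorization_def _ hp, Nat.factorization_prod_apply (fun i _ ↦ by positivity)]
  simp_rw [card_filter]
  rw [sum_comm]
  refine sum_congr rfl fun i hi ↦ ?_
  have hi' : i ^ 2 + 1 < p ^ (K + 1) := by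
    refine lt_of_le_of_lt ?_ hK
    gcongr
    exact (mem_Icc.1 hi).2
  rw [Nat.factorization_eq_card_pow_dvd_of_lt hp (by positivity) hi', card_filter]
  rfl

open Finset in
lemma sum_Icc_div_pow {x : ℝ} (hx : 1 < x) (c : ℝ) (K : ℕ) :
    ∑ k ∈ Icc 1 K, c / x ^ k = c / (x - 1) - c * x / ((x - 1) * x ^ (K + 1)) := by
  have h0 : x ≠ 0 := by positivity
  have h1 : x - 1 ≠ 0 := by linarith
  induction K with
  | zero => simp; field_simp; ring
  | succ K ih =>
    rw [sum_Icc_succ_top (by omega), ih]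
    field_simp
    ring

/-- `log q ≤ 2 √q`, in the form needed to bound the tail of the geometric series. -/
lemma mul_log_le_two_mul {x q : ℝ} (hx : 0 ≤ x) (hq : x ^ 2 ≤ q) (hq0 : 0 < q) :
    x * Real.log q ≤ 2 * q := by
  have hs : 0 < √q := Real.sqrt_pos.2 hq0
  have h1 : Real.log q ≤ 2 * √q := by
    rw [← Real.sq_sqrt hq0.le, Real.log_pow, Real.sqrt_sq hs.le]
    have := Real.log_le_sub_one_of_pos hs
    push_cast
    linarith
  calc x * Real.log q ≤ x * (2 * √q) := by gcongr
    _ ≤ √q * (2 * √q) := by gcongr; exact Real.le_sqrt_of_sq_le hq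
    _ = 2 * q := by rw [mul_left_comm, Real.mul_self_sqrt hq0.le]

/-- There exists `C > 0` such that for every prime `p ≡ 1 (mod 4)` and every `n ≥ 2`,
`|α_p(n) − 2n/(p−1)| ≤ C·(log n)/(log p)`. -/
theorem padicValNat_prod_sq_add_one_asymp :
    ∃ C > 0, ∀ p : ℕ, p.Prime → p % 4 = 1 → ∀ n : ℕ, 2 ≤ n →
      |(padicValNat p (∏ i ∈ Finset.Icc 1 n, (i ^ 2 + 1)) : ℝ)
          - 2 * n / ((p : ℝ) - 1)| ≤ C * Real.log n / Real.log p := by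
  refine ⟨20, by norm_num, ?_⟩
  intro p hp h4 n hn
  have hn' : (2 : ℝ) ≤ n := by exact_mod_cast hn
  have hp5 : (5 : ℝ) ≤ p := by
    have := hp.two_le
    exact_mod_cast (by omega : 5 ≤ p)
  set K := Nat.log p (n ^ 2 + 1)
  have hK : n ^ 2 + 1 < p ^ (K + 1) := Nat.lt_pow_succ_log_self hp.one_lt _
  have hK' : p ^ K ≤ n ^ 2 + 1 := Nat.pow_log_le_self p (by positivity)
  have hlogp : 0 < Real.log p := Real.log_pos (by linarith)
  have hlogn : 1 / 2 ≤ Real.log n := by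
    have := Real.log_le_log two_pos hn'
    linarith [Real.log_two_gt_d9]
  have hKlog : K * Real.log p ≤ 3 * Real.log n := by
    have h1 : (p : ℝ) ^ K ≤ (n : ℝ) ^ 3 := by
      have : (p : ℝ) ^ K ≤ (n : ℝ) ^ 2 + 1 := by exact_mod_cast hK'
      nlinarith [sq_nonneg (n : ℝ)]
    have h2 := Real.log_le_log (by positivity) h1
    rw [Real.log_pow, Real.log_pow] at h2
    exact_mod_cast h2
  have hmain : |(padicValNat p (∏ i ∈ Finset.Icc 1 n, (i ^ 2 + 1)) : ℝ)
      - ∑ k ∈ Finset.Icc 1 K, 2 * n / (p : ℝ) ^ k| ≤ 2 * K := by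
    rw [padicValNat_prod_sq_add_one_eq_sum hp hK, Nat.cast_sum, ← Finset.sum_sub_distrib]
    refine (Finset.abs_sum_le_sum_abs _ _).trans ?_
    refine (Finset.sum_le_card_nsmul _ _ 2 fun k hk ↦ ?_).trans ?_
    · have := (Finset.mem_Icc.1 hk).1
      exact abs_card_pow_dvd_sq_add_one_sub_le hp h4 (by omega) n
    · simp [mul_comm]
  have htail : 2 * n * (p : ℝ) / ((p - 1) * (p : ℝ) ^ (K + 1)) * Real.log p ≤ 5 := by
    have hq : (n : ℝ) ^ 2 + 1 < (p : ℝ) ^ (K + 1) := by exact_mod_cast hK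
    have hq0 : 0 < (p : ℝ) ^ (K + 1) := by positivity
    have h1 : n * Real.log p ≤ 2 * (p : ℝ) ^ (K + 1) := by
      refine le_trans ?_ (mul_log_le_two_mul n.cast_nonneg (by linarith) hq0)
      gcongr
      exact le_self_pow₀ (by linarith) (by omega)
    rw [div_mul_eq_mul_div, div_le_iff₀ (mul_pos (by linarith) hq0)]
    nlinarith
  have htail0 : 0 ≤ 2 * n * (p : ℝ) / ((p - 1) * (p : ℝ) ^ (K + 1)) :=
    div_nonneg (by positivity) (mul_nonneg (by linarith) (by positivity))
  rw [sum_Icc_div_pow (by linarith)] at hmain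
  rw [le_div_iff₀ hlogp]
  have hbound : |(padicValNat p (∏ i ∈ Finset.Icc 1 n, (i ^ 2 + 1)) : ℝ)
      - 2 * n / ((p : ℝ) - 1)| ≤ 2 * K + 2 * n * (p : ℝ) / ((p - 1) * (p : ℝ) ^ (K + 1)) := by
    rw [abs_le] at hmain ⊢
    constructor <;> linarith [hmain.1, hmain.2]
  refine (mul_le_mul_of_nonneg_right hbound hlogp.le).trans ?_
  linarith
end

section
/- There exists a constant C > 0 such that for all integers n ≥ 1, the number of primes p with n^{2/3} ≤ p ≤ 2n for which p² divides i²+1 for some integer 1 ≤ i ≤ n is at most C·n^{2/3}. -/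
open scoped Classical

/-- Two positive solutions of the negative Pell equation `x² + 1 = k y²` have second coordinates
that differ by more than a factor of two. -/
theorem two_mul_lt_of_negative_pell {k x y x' y' : ℤ} (hx : 0 < x) (hy : 0 < y) (hx' : 0 < x')
    (h : x ^ 2 + 1 = k * y ^ 2) (h' : x' ^ 2 + 1 = k * y' ^ 2) (hlt : y < y') :
    2 * y < y' := by
  have hk : 2 ≤ k := by
    by_contra! hk
    rcases (show k ≤ 0 ∨ k = 1 by lia) with hk | rfl
    · nlinarith [sq_nonneg y, sq_nonneg x]
    · have : x < y := by nlinarith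
      nlinarith
  have hy' : 0 < y' := hy.trans hlt
  have hyx : y ≤ x := by nlinarith
  have hyx' : y' ≤ x' := by nlinarith
  have key : (x' * y - x * y') * (x' * y + x * y') = y' ^ 2 - y ^ 2 := by
    linear_combination y ^ 2 * h' - y' ^ 2 * h
  have hsum : 0 < x' * y + x * y' := by positivity
  have hdiff : 0 < x' * y - x * y' := by
    refine pos_of_mul_pos_left (b := x' * y + x * y') ?_ hsum.le
    rw [key]
    nlinarith
  have hle : x' * y + x * y' ≤ y' ^ 2 - y ^ 2 := by
    rw [← key]
    nlinarith
  have hle' : 2 * (y * y') ≤ y' ^ 2 - y ^ 2 := by nlinarith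
  by_contra! hcon
  nlinarith [mul_pos hy hy]

/-- The `m ≥ M` up to `2n` whose square divides some `i² + 1` with `1 ≤ i ≤ n`. -/
noncomputable def squareDividing (n M : ℕ) : Finset ℕ :=
  (Finset.range (2 * n + 1)).filter
    (fun m : ℕ => M ≤ m ∧ ∃ i ∈ Finset.Icc 1 n, m ^ 2 ∣ i ^ 2 + 1)

theorem card_filter_squareDividing_mul_sq_le {n M : ℕ} (hM : 1 ≤ M) :
    ((squareDividing n M).filter (· < 2 * M)).card * M ^ 2 ≤ 2 * n ^ 2 := by
  have hex : ∀ m ∈ (squareDividing n M).filter (· < 2 * M),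
      ∃ k i : ℕ, 1 ≤ i ∧ i ≤ n ∧ i ^ 2 + 1 = k * m ^ 2 := by
    intro m hm
    simp only [squareDividing, Finset.mem_filter, Finset.mem_Icc] at hm
    obtain ⟨⟨-, -, i, ⟨hi, hin⟩, k, hk⟩, -⟩ := hm
    exact ⟨k, i, hi, hin, by rw [hk, mul_comm]⟩
  choose! f g hg hgn hfg using hex
  have hbounds : ∀ m ∈ (squareDividing n M).filter (· < 2 * M), M ≤ m ∧ m < 2 * M := by
    intro m hm
    simp only [squareDividing, Finset.mem_filter] at hm
    exact ⟨hm.1.2.1, hm.2⟩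
  have hgap : ∀ a ∈ (squareDividing n M).filter (· < 2 * M),
      ∀ b ∈ (squareDividing n M).filter (· < 2 * M), f a = f b → ¬ a < b := by
    intro a ha b hb hab hlt
    have hA := hfg a ha
    have hB := hfg b hb
    rw [← hab] at hB
    have hga := hg a ha
    have hgb := hg b hb
    have hMa := hbounds a ha
    have hMb := hbounds b hb
    have := two_mul_lt_of_negative_pell (k := f a) (x := g a) (y := a) (x' := g b) (y' := b)
      (by lia) (by lia) (by lia) (by exact_mod_cast hA) (by exact_mod_cast hB) (by lia)
    lia
  have hcard : ((squareDividing n M).filter (· < 2 * M)).card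
      ≤ (Finset.Icc 1 (2 * n ^ 2 / M ^ 2)).card := by
    refine Finset.card_le_card_of_injOn f ?_ ?_
    · intro m hm
      have hfm := hfg m hm
      have hMm := (hbounds m hm).1
      have hgm := hg m hm
      have hgmn := hgn m hm
      simp only [Finset.coe_Icc, Set.mem_Icc]
      constructor
      · by_contra! h0
        have : f m = 0 := by lia
        simp [this] at hfm
      · rw [Nat.le_div_iff_mul_le (by positivity)]
        calc f m * M ^ 2 ≤ f m * m ^ 2 := by gcongr
          _ = g m ^ 2 + 1 := hfm.symm
          _ ≤ 2 * n ^ 2 := by nlinarith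
    · intro a ha b hb hab
      exact le_antisymm (not_lt.mp (hgap b hb a ha hab.symm)) (not_lt.mp (hgap a ha b hb hab))
  rw [Nat.card_Icc, Nat.add_sub_cancel] at hcard
  exact (Nat.mul_le_mul_right _ hcard).trans (Nat.div_mul_le_self _ _)

theorem card_squareDividing_mul_sq_le (n M : ℕ) (hM : 1 ≤ M) :
    (squareDividing n M).card * M ^ 2 ≤ 4 * n ^ 2 := by
  induction hd : 2 * n + 1 - M using Nat.strong_induction_on generalizing M with
  | _ d ih =>
    by_cases hMn : 2 * n < M
    · have : squareDividing n M = ∅ := by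
        refine Finset.filter_eq_empty_iff.mpr fun m hm h => ?_
        have := Finset.mem_range.mp hm
        lia
      simp [this]
    · have hrec := ih (2 * n + 1 - 2 * M) (by lia) (2 * M) (by lia) rfl
      have hlow := card_filter_squareDividing_mul_sq_le (n := n) hM
      have hsplit := Finset.card_filter_add_card_filter_not (s := squareDividing n M) (· < 2 * M)
      have hhigh : (squareDividing n M).filter (¬ · < 2 * M) ⊆ squareDividing n (2 * M) := by
        intro m hm
        simp only [squareDividing, Finset.mem_filter] at hm ⊢
        exact ⟨hm.1.1, by lia, hm.1.2.2⟩
      have hle := Finset.card_le_card hhigh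
      rw [← hsplit]
      nlinarith [Nat.mul_le_mul_right (M ^ 2) hle]

/-- There exists `C > 0` such that for all `n ≥ 1`, the number of primes `p` with
`n^{2/3} ≤ p ≤ 2n` such that `p²` divides `i²+1` for some `1 ≤ i ≤ n` is at most `C·n^{2/3}`. -/
theorem card_primes_square_dividing :
    ∃ C > 0, ∀ n : ℕ, 1 ≤ n →
      (((Finset.range (2 * n + 1)).filter
          (fun p : ℕ => p.Prime ∧ (n : ℝ) ^ ((2 : ℝ) / 3) ≤ (p : ℝ) ∧ p ≤ 2 * n ∧
            ∃ i ∈ Finset.Icc 1 n, p ^ 2 ∣ i ^ 2 + 1)).card : ℝ)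
        ≤ C * (n : ℝ) ^ ((2 : ℝ) / 3) := by
  refine ⟨4, by norm_num, fun n hn => ?_⟩
  have hn0 : (0 : ℝ) < n := by exact_mod_cast hn
  set r : ℝ := (n : ℝ) ^ ((2 : ℝ) / 3) with hr
  have hr0 : 0 < r := Real.rpow_pos_of_pos hn0 _
  have hr3 : r ^ 3 = (n : ℝ) ^ 2 := by
    rw [hr, ← Real.rpow_natCast, ← Real.rpow_mul hn0.le, ← Real.rpow_natCast]
    norm_num
  have hsub : (Finset.range (2 * n + 1)).filter
      (fun p : ℕ => p.Prime ∧ r ≤ (p : ℝ) ∧ p ≤ 2 * n ∧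
        ∃ i ∈ Finset.Icc 1 n, p ^ 2 ∣ i ^ 2 + 1) ⊆ squareDividing n ⌈r⌉₊ := by
    intro p hp
    simp only [squareDividing, Finset.mem_filter] at hp ⊢
    exact ⟨hp.1, Nat.ceil_le.mpr hp.2.2.1, hp.2.2.2.2⟩
  refine (Nat.cast_le.mpr (Finset.card_le_card hsub)).trans ?_
  have hmain : ((squareDividing n ⌈r⌉₊).card : ℝ) * (⌈r⌉₊ : ℝ) ^ 2 ≤ 4 * (n : ℝ) ^ 2 := by
    exact_mod_cast card_squareDividing_mul_sq_le n ⌈r⌉₊ (Nat.ceil_pos.mpr hr0)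
  refine le_of_mul_le_mul_right ?_ (pow_pos hr0 2)
  calc ((squareDividing n ⌈r⌉₊).card : ℝ) * r ^ 2
      ≤ (squareDividing n ⌈r⌉₊).card * (⌈r⌉₊ : ℝ) ^ 2 := by
        gcongr
        exact Nat.le_ceil r
    _ ≤ 4 * (n : ℝ) ^ 2 := hmain
    _ = 4 * r * r ^ 2 := by rw [← hr3]; ring
end

section
/- There exists a constant C > 0 such that for all integers n ≥ 2, |Σ_{n^{2/3} ≤ p ≤ 2n, p prime} (β_p(n) − β*_p(n) − α_p(n) + α*_p(n))·log p| ≤ C·n^{2/3}·log n. -/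
open scoped Classical

/-- Gap principle for two solutions of the negative Pell equation `i² + 1 = m p²`. -/
lemma add_lt_of_sq_add_one_eq_mul_sq {m p q i j : ℕ} (hm : 2 ≤ m) (hi : i ^ 2 + 1 = m * p ^ 2)
    (hj : j ^ 2 + 1 = m * q ^ 2) (hpq : p < q) : i + p < q := by
  have hqj : q ≤ j := by
    by_contra! h
    nlinarith [Nat.mul_le_mul_right (q ^ 2) hm]
  have key : (i * q) ^ 2 + q ^ 2 = (j * p) ^ 2 + p ^ 2 := by
    linear_combination q ^ 2 * hi - p ^ 2 * hj
  have hlt : i * q < j * p := by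
    by_contra! h
    nlinarith [Nat.pow_le_pow_left h 2]
  have hsum : j * p + i * q ≤ q ^ 2 := by nlinarith
  by_contra! h
  have h₁ : q * q ≤ (i + p) * q := Nat.mul_le_mul_right q h
  have h₂ : q * p ≤ j * p := Nat.mul_le_mul_right p hqj
  have hp : 0 < p := by
    rcases Nat.eq_zero_or_pos p with rfl | h
    · simp at hi
    · exact h
  nlinarith

lemma two_le_of_sq_add_one_eq_mul_sq {m p i : ℕ} (hi0 : 1 ≤ i) (hi : i ^ 2 + 1 = m * p ^ 2) :
    2 ≤ m := by
  by_contra! h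
  interval_cases m
  · simp at hi
  · have : i < p := by nlinarith
    nlinarith

lemma cube_le_of_mul_sq_le {m p n : ℕ} (hn : 1 ≤ n) (hp : n ^ 2 ≤ p ^ 3)
    (h : m * p ^ 2 ≤ n ^ 2 + 1) : m ^ 3 ≤ 8 * n ^ 2 := by
  have h₁ : m * p ^ 2 ≤ 2 * n ^ 2 := by nlinarith
  have h₂ : (m * p ^ 2) ^ 3 ≤ (2 * n ^ 2) ^ 3 := Nat.pow_le_pow_left h₁ 3
  have h₃ : (n ^ 2) ^ 2 ≤ (p ^ 3) ^ 2 := Nat.pow_le_pow_left hp 2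
  have h₄ : m ^ 3 * (n ^ 2) ^ 2 ≤ m ^ 3 * (p ^ 3) ^ 2 := Nat.mul_le_mul_left _ h₃
  have h₅ : m ^ 3 * n ^ 4 ≤ (8 * n ^ 2) * n ^ 4 := by
    calc _ = m ^ 3 * (n ^ 2) ^ 2 := by ring
      _ ≤ m ^ 3 * (p ^ 3) ^ 2 := h₄
      _ = (m * p ^ 2) ^ 3 := by ring
      _ ≤ (2 * n ^ 2) ^ 3 := h₂
      _ = _ := by ring
  exact Nat.le_of_mul_le_mul_right h₅ (by positivity)

/-- If `m` is the cofactor of two solutions, then `m` is `O(n^{1/3})`. -/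
lemma cube_le_of_two_solutions {m p q i j n : ℕ} (hn : 1 ≤ n) (hi0 : 1 ≤ i) (hjn : j ≤ n)
    (hp : n ^ 2 ≤ p ^ 3) (hi : i ^ 2 + 1 = m * p ^ 2) (hj : j ^ 2 + 1 = m * q ^ 2)
    (hpq : p < q) : m ^ 3 ≤ 3 * n := by
  have hgap := add_lt_of_sq_add_one_eq_mul_sq (two_le_of_sq_add_one_eq_mul_sq hi0 hi) hi hj hpq
  have h₁ : m * p ^ 2 ≤ q ^ 2 := by rw [← hi]; nlinarith
  have h₂ : m ^ 2 * p ^ 2 ≤ n ^ 2 + 1 := by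
    nlinarith [Nat.mul_le_mul_left m h₁, Nat.pow_le_pow_left hjn 2]
  have h₃ := cube_le_of_mul_sq_le hn hp h₂
  refine (Nat.pow_le_pow_iff_left (n := 2) (by norm_num)).1 ?_
  calc (m ^ 3) ^ 2 = (m ^ 2) ^ 3 := by ring
    _ ≤ 8 * n ^ 2 := h₃
    _ ≤ (3 * n) ^ 2 := by nlinarith

lemma le_floor_of_cube_le {m : ℕ} {y : ℝ} (hy : 0 ≤ y) (h : (m : ℝ) ^ 3 ≤ y ^ 3) :
    m ≤ ⌊y⌋₊ :=
  Nat.le_floor (le_of_pow_le_pow_left₀ (by norm_num) hy h)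

lemma natLog_two_le {n : ℕ} {x : ℝ} (hn : 1 ≤ n) (hx : 0 < x) (hxn : x ^ 3 = n) :
    (Nat.log 2 n : ℝ) ≤ 6 * x := by
  have hpow : ((2 ^ Nat.log 2 n : ℕ) : ℝ) ≤ n := by
    exact_mod_cast Nat.pow_log_le_self 2 (by omega)
  have hlog := Real.log_le_log (by positivity) hpow
  rw [← hxn, Nat.cast_pow, Real.log_pow, Real.log_pow] at hlog
  have h2 : (1 : ℝ) / 2 ≤ Real.log 2 := by linarith [Real.log_two_gt_d9]
  have hlx := Real.log_le_sub_one_of_pos hx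
  push_cast at hlog
  nlinarith [mul_le_mul_of_nonneg_left h2 (Nat.cast_nonneg (α := ℝ) (Nat.log 2 n))]

/-- The pairs `(p, i)` with `p² ∣ i² + 1`, `i ≤ n` and `n^{2/3} ≤ p` number `O(n^{2/3})`. -/
lemma card_sigma_sq_dvd_le {n : ℕ} (hn : 1 ≤ n) {x : ℝ} (hx : 1 ≤ x) (hxn : x ^ 3 = n)
    (S : Finset ℕ) (hS : ∀ p ∈ S, p ≤ 2 * n ∧ n ^ 2 ≤ p ^ 3) :
    ((S.sigma fun p => (Finset.Icc 1 n).filter fun i => p ^ 2 ∣ i ^ 2 + 1).card : ℝ)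
      ≤ 18 * x ^ 2 := by
  set T := S.sigma fun p => (Finset.Icc 1 n).filter fun i => p ^ 2 ∣ i ^ 2 + 1 with hT
  let m : (Σ _ : ℕ, ℕ) → ℕ := fun t => (t.2 ^ 2 + 1) / t.1 ^ 2
  have mem : ∀ t ∈ T, t.1 ≤ 2 * n ∧ n ^ 2 ≤ t.1 ^ 3 ∧ 1 ≤ t.2 ∧ t.2 ≤ n ∧
      t.2 ^ 2 + 1 = m t * t.1 ^ 2 := by
    intro t ht
    simp only [hT, Finset.mem_sigma, Finset.mem_filter, Finset.mem_Icc] at ht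
    obtain ⟨h₁, ⟨h₂, h₃⟩, h₄⟩ := ht
    exact ⟨(hS _ h₁).1, (hS _ h₁).2, h₂, h₃, (Nat.div_mul_cancel h₄).symm⟩
  have ext_of : ∀ s ∈ T, ∀ t ∈ T, m s = m t → s.1 = t.1 → s = t := by
    intro s hs t ht hm hst
    obtain ⟨_, _, _, _, h₁⟩ := mem s hs
    obtain ⟨_, _, _, _, h₂⟩ := mem t ht
    have : s.2 ^ 2 = t.2 ^ 2 := by rw [hm, hst, ← h₂] at h₁; omega
    have : s.2 = t.2 := Nat.pow_left_injective (n := 2) (by norm_num) this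
    exact Sigma.ext hst (heq_of_eq this)
  have hmpos : ∀ t ∈ T, 1 ≤ m t := by
    intro t ht
    obtain ⟨_, _, h, _, h'⟩ := mem t ht
    exact (two_le_of_sq_add_one_eq_mul_sq h h').trans' (by norm_num)
  have hlarge : (T.filter fun t => ¬ m t ^ 3 ≤ 3 * n).card ≤ (Finset.Icc 1 ⌊2 * x ^ 2⌋₊).card := by
    refine Finset.card_le_card_of_injOn m ?_ ?_
    · intro t ht
      have ht := (Finset.mem_filter.1 ht).1
      obtain ⟨_, h₂, h₃, h₄, h₅⟩ := mem t ht
      have h₆ : m t ^ 3 ≤ 8 * n ^ 2 :=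
        cube_le_of_mul_sq_le hn h₂ (by rw [← h₅]; gcongr)
      refine Finset.mem_coe.2 (Finset.mem_Icc.2 ⟨hmpos t ht, ?_⟩)
      refine le_floor_of_cube_le (by positivity) ?_
      calc (m t : ℝ) ^ 3 ≤ 8 * (n : ℝ) ^ 2 := by exact_mod_cast h₆
        _ = _ := by rw [← hxn]; ring
    · intro s hs t ht hm
      obtain ⟨hs, hs'⟩ := Finset.mem_filter.1 hs
      obtain ⟨ht, ht'⟩ := Finset.mem_filter.1 ht
      obtain ⟨_, a₂, a₃, a₄, a₅⟩ := mem s hs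
      obtain ⟨_, b₂, b₃, b₄, b₅⟩ := mem t ht
      rcases lt_trichotomy s.1 t.1 with h | h | h
      · exact absurd (cube_le_of_two_solutions hn a₃ b₄ a₂ a₅ (hm ▸ b₅) h) hs'
      · exact ext_of s hs t ht hm h
      · exact absurd (cube_le_of_two_solutions hn b₃ a₄ b₂ b₅ (hm ▸ a₅) h) ht'
  have hsmall : (T.filter fun t => m t ^ 3 ≤ 3 * n).card ≤
      (Finset.Icc 1 ⌊2 * x⌋₊ ×ˢ Finset.range (Nat.log 2 (2 * n) + 1)).card := by
    refine Finset.card_le_card_of_injOn (fun t => (m t, Nat.log 2 t.1)) ?_ ?_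
    · intro t ht
      obtain ⟨ht, ht'⟩ := Finset.mem_filter.1 ht
      refine Finset.mem_coe.2 (Finset.mem_product.2 ⟨Finset.mem_Icc.2 ⟨hmpos t ht, ?_⟩, ?_⟩)
      · refine le_floor_of_cube_le (by positivity) ?_
        calc (m t : ℝ) ^ 3 ≤ 3 * (n : ℝ) := by exact_mod_cast ht'
          _ ≤ 8 * (n : ℝ) := by gcongr; norm_num
          _ = _ := by rw [← hxn]; ring
      · exact Finset.mem_range.2 (Nat.lt_succ_of_le (Nat.log_mono_right (b := 2) (mem t ht).1))
    · have log_lt : ∀ s ∈ T, ∀ t ∈ T, m s = m t → s.1 < t.1 →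
          Nat.log 2 s.1 < Nat.log 2 t.1 := by
        intro s hs t ht hm h
        obtain ⟨_, a₂, a₃, a₄, a₅⟩ := mem s hs
        obtain ⟨_, b₂, b₃, b₄, b₅⟩ := mem t ht
        have h2 := two_le_of_sq_add_one_eq_mul_sq a₃ a₅
        have hgap := add_lt_of_sq_add_one_eq_mul_sq h2 a₅ (hm ▸ b₅) h
        have hle : s.1 ≤ s.2 := by
          by_contra! h
          nlinarith [Nat.mul_le_mul_right (s.1 ^ 2) h2]
        have hpos : s.1 ≠ 0 := by
          intro h0
          simp [h0] at a₅
        calc Nat.log 2 s.1 < Nat.log 2 (s.1 * 2) := by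
              rw [Nat.log_mul_base (by norm_num) hpos]; exact Nat.lt_succ_self _
          _ ≤ Nat.log 2 t.1 := Nat.log_mono_right (by omega)
      intro s hs t ht hst
      have hs := (Finset.mem_filter.1 hs).1
      have ht := (Finset.mem_filter.1 ht).1
      obtain ⟨hm, hl⟩ := Prod.ext_iff.1 hst
      simp only at hm hl
      rcases lt_trichotomy s.1 t.1 with h | h | h
      · exact absurd hl (log_lt s hs t ht hm h).ne
      · exact ext_of s hs t ht hm h
      · exact absurd hl (log_lt t ht s hs hm.symm h).ne'
  rw [Nat.card_Icc, Nat.add_sub_cancel] at hlarge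
  rw [Finset.card_product, Nat.card_Icc, Nat.add_sub_cancel, Finset.card_range, mul_comm 2 n,
    Nat.log_mul_base (by norm_num) (by omega)] at hsmall
  rw [← Finset.card_filter_add_card_filter_not (s := T) (fun t => m t ^ 3 ≤ 3 * n)]
  have f₁ : (⌊2 * x ^ 2⌋₊ : ℝ) ≤ 2 * x ^ 2 := Nat.floor_le (by positivity)
  have f₂ : (⌊2 * x⌋₊ : ℝ) ≤ 2 * x := Nat.floor_le (by positivity)
  have f₃ := natLog_two_le hn (by linarith) hxn
  have hlarge' : ((T.filter fun t => ¬ m t ^ 3 ≤ 3 * n).card : ℝ) ≤ ⌊2 * x ^ 2⌋₊ := by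
    exact_mod_cast hlarge
  have hsmall' : ((T.filter fun t => m t ^ 3 ≤ 3 * n).card : ℝ) ≤
      ⌊2 * x⌋₊ * (Nat.log 2 n + 1 + 1) := by
    exact_mod_cast hsmall
  have f₄ : (⌊2 * x⌋₊ : ℝ) * (Nat.log 2 n + 1 + 1) ≤ (2 * x) * (6 * x + 1 + 1) := by gcongr
  push_cast
  nlinarith

/-- The exponent of `p` in `i² + 1` beyond the first power, for `p ≥ n^{2/3}`. -/
lemma padicValNat_sq_add_one_le {p i n : ℕ} (hp : p.Prime) (hn : 2 ≤ n) (hi : i ≤ n)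
    (hpn : n ^ 2 ≤ p ^ 3) :
    padicValNat p (i ^ 2 + 1) ≤
      (if p ∣ i ^ 2 + 1 then 1 else 0) + 2 * (if p ^ 2 ∣ i ^ 2 + 1 then 1 else 0) := by
  have := Fact.mk hp
  have hne : i ^ 2 + 1 ≠ 0 := by omega
  have h4 : padicValNat p (i ^ 2 + 1) < 4 := by
    by_contra! h
    have hd := Nat.le_of_dvd (by omega) ((padicValNat_dvd_iff_le hne).2 h)
    nlinarith [hp.two_le, Nat.pow_le_pow_left hi 2, Nat.mul_le_mul hpn hp.two_le]
  have d₁ : p ∣ i ^ 2 + 1 ↔ 1 ≤ padicValNat p (i ^ 2 + 1) := by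
    rw [← padicValNat_dvd_iff_le hne, pow_one]
  have d₂ : p ^ 2 ∣ i ^ 2 + 1 ↔ 2 ≤ padicValNat p (i ^ 2 + 1) := padicValNat_dvd_iff_le hne
  simp only [d₁, d₂]
  split_ifs <;> omega

lemma padicValNat_finset_prod {ι : Type*} (s : Finset ι) (f : ι → ℕ) (p : ℕ) [Fact p.Prime]
    (hf : ∀ i ∈ s, f i ≠ 0) :
    padicValNat p (∏ i ∈ s, f i) = ∑ i ∈ s, padicValNat p (f i) := by
  simpa only [Nat.factorization_def _ (Fact.out : p.Prime)] using
    Nat.factorization_prod_apply (p := p) hf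

/-- The exponent of `p` in an lcm exceeds `1` by at most the total excess of the factors. -/
lemma padicValNat_finset_lcm_add_card_le {ι : Type*} (s : Finset ι) (f : ι → ℕ) (p : ℕ)
    [Fact p.Prime] (hf : ∀ i ∈ s, f i ≠ 0) :
    padicValNat p (s.lcm f) + (s.filter fun i => p ∣ f i).card ≤
      1 + ∑ i ∈ s, padicValNat p (f i) := by
  have key : ∀ i ∈ s, (if p ∣ f i then 1 else 0) ≤ padicValNat p (f i) := by
    intro i hi
    split_ifs with h
    · exact one_le_padicValNat_of_dvd (hf i hi) h
    · exact Nat.zero_le _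
  rw [Finset.card_filter]
  have hlcm0 : s.lcm f ≠ 0 := by
    rw [Ne, Finset.lcm_eq_zero_iff]
    rintro ⟨i, hi, h⟩
    exact hf i hi h
  by_cases hz : padicValNat p (s.lcm f) = 0
  · rw [hz, zero_add]
    exact (Finset.sum_le_sum key).trans (Nat.le_add_left _ _)
  · obtain ⟨i, hi, hv⟩ : ∃ i ∈ s, padicValNat p (s.lcm f) ≤ padicValNat p (f i) := by
      have hs : s.Nonempty := by
        refine Finset.nonempty_iff_ne_empty.2 fun h => hz ?_
        simp [h]
      have hsup := Finset.factorization_lcm hf p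
      obtain ⟨i, hi, h⟩ := Finset.exists_mem_eq_sup s hs fun i => (f i).factorization p
      simp only [Nat.factorization_def _ (Fact.out : p.Prime)] at hsup h
      exact ⟨i, hi, (hsup.trans h).le⟩
    rw [← Finset.add_sum_erase s _ hi, ← Finset.add_sum_erase s (fun i => padicValNat p (f i)) hi]
    have := Finset.sum_le_sum fun j (hj : j ∈ s.erase i) => key j (Finset.mem_of_mem_erase hj)
    have h1 : (if p ∣ f i then 1 else 0) ≤ 1 := by split_ifs <;> norm_num
    omega

/-- A prime `p ≡ 1 (mod 4)` divides `i² + 1` for some `1 ≤ i ≤ p / 2`. -/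
lemma exists_dvd_sq_add_one {p n : ℕ} (hp : p.Prime) (h4 : p % 4 = 1) (hpn : p ≤ 2 * n) :
    ∃ i ∈ Finset.Icc 1 n, p ∣ i ^ 2 + 1 := by
  have := Fact.mk hp
  obtain ⟨y, hy⟩ := ZMod.exists_sq_eq_neg_one_iff.2 (show p % 4 ≠ 3 by omega)
  have hdvd : (p : ℤ) ∣ y.valMinAbs ^ 2 + 1 := by
    rw [← ZMod.intCast_zmod_eq_zero_iff_dvd]
    push_cast
    rw [sq, ← hy, neg_add_cancel]
  refine ⟨y.valMinAbs.natAbs, Finset.mem_Icc.2 ⟨?_, ?_⟩, ?_⟩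
  · rw [Nat.one_le_iff_ne_zero, Ne, Int.natAbs_eq_zero]
    intro h
    rw [h] at hdvd
    have := Int.le_of_dvd (by norm_num) hdvd
    have := hp.two_le
    omega
  · have := ZMod.natAbs_valMinAbs_le y
    omega
  · rw [← Int.natCast_dvd_natCast]
    push_cast
    rwa [sq_abs]

/-- Contribution of a single prime `n^{2/3} ≤ p ≤ 2n`. -/
lemma abs_medium_prime_term_le {p n : ℕ} (hp : p.Prime) (hn : 2 ≤ n) (hp2 : p ≤ 2 * n)
    (hp3 : n ^ 2 ≤ p ^ 3) :
    |(padicValNat p ((Finset.Icc 1 n).lcm (fun i => i ^ 2 + 1)) : ℝ)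
        - (if p % 4 = 1 then (1 : ℝ) else 0)
        - (padicValNat p (∏ i ∈ Finset.Icc 1 n, (i ^ 2 + 1)) : ℝ)
        + (if p % 4 = 1
            then (((Finset.Icc 1 n).filter (fun i => p ∣ i ^ 2 + 1)).card : ℝ)
            else 0)|
      ≤ 2 * (((Finset.Icc 1 n).filter fun i => p ^ 2 ∣ i ^ 2 + 1).card : ℝ) := by
  have := Fact.mk hp
  have hne : ∀ i ∈ Finset.Icc 1 n, i ^ 2 + 1 ≠ 0 := fun i _ => Nat.succ_ne_zero _
  by_cases h4 : p % 4 = 1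
  · simp only [h4, if_true]
    have hlow : 1 ≤ padicValNat p ((Finset.Icc 1 n).lcm fun i => i ^ 2 + 1) := by
      obtain ⟨i, hi, hd⟩ := exists_dvd_sq_add_one hp h4 hp2
      refine one_le_padicValNat_of_dvd ?_
        (hd.trans (Finset.dvd_lcm (f := fun i => i ^ 2 + 1) hi))
      rw [Ne, Finset.lcm_eq_zero_iff]
      rintro ⟨j, hj, h⟩
      exact hne j hj h
    have hup := padicValNat_finset_lcm_add_card_le (Finset.Icc 1 n) (fun i => i ^ 2 + 1) p hne
    have hsum := Finset.sum_le_sum fun i (hi : i ∈ Finset.Icc 1 n) =>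
      padicValNat_sq_add_one_le hp hn (Finset.mem_Icc.1 hi).2 hp3
    rw [Finset.sum_add_distrib, ← Finset.mul_sum, ← Finset.card_filter, ← Finset.card_filter,
      ← padicValNat_finset_prod _ _ p hne] at hsum
    rw [← padicValNat_finset_prod _ _ p hne] at hup
    generalize padicValNat p ((Finset.Icc 1 n).lcm fun i => i ^ 2 + 1) = b at *
    generalize padicValNat p (∏ i ∈ Finset.Icc 1 n, (i ^ 2 + 1)) = a at *
    generalize ((Finset.Icc 1 n).filter fun i => p ∣ i ^ 2 + 1).card = c at *
    generalize ((Finset.Icc 1 n).filter fun i => p ^ 2 ∣ i ^ 2 + 1).card = d at *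
    rw [abs_le]
    constructor
    · linarith [show (a : ℝ) ≤ c + 2 * d by exact_mod_cast hsum, show (1 : ℝ) ≤ b by exact_mod_cast hlow]
    · linarith [show (b : ℝ) + c ≤ 1 + a by exact_mod_cast hup]
  · simp only [h4, if_false]
    have hval : padicValNat p ((Finset.Icc 1 n).lcm fun i => i ^ 2 + 1) =
        padicValNat p (∏ i ∈ Finset.Icc 1 n, (i ^ 2 + 1)) := by
      rcases hp.eq_two_or_odd with rfl | hodd
      · have : n = 2 := by nlinarith
        subst this
        congr 1
      · have hnd : ∀ i, ¬ p ∣ i ^ 2 + 1 := by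
          intro i hd
          have hsq : (i : ZMod p) ^ 2 = -1 := by
            rw [← ZMod.natCast_eq_zero_iff] at hd
            push_cast at hd
            exact eq_neg_of_add_eq_zero_left hd
          have := ZMod.exists_sq_eq_neg_one_iff.1 ⟨(i : ZMod p), by rw [← hsq, sq]⟩
          omega
        have hprod : ¬ p ∣ ∏ i ∈ Finset.Icc 1 n, (i ^ 2 + 1) := by
          rw [hp.prime.dvd_finsetProd_iff]
          rintro ⟨i, _, hd⟩
          exact hnd i hd
        rw [padicValNat.eq_zero_of_not_dvd hprod, padicValNat.eq_zero_of_not_dvd]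
        exact fun h => hprod (h.trans (Finset.lcm_dvd fun i hi => Finset.dvd_prod_of_mem _ hi))
    rw [hval]
    simp

/-- There exists `C > 0` such that for all `n ≥ 2`,
`|Σ_{n^{2/3} ≤ p ≤ 2n} (β_p(n) − β*_p(n) − α_p(n) + α*_p(n))·log p| ≤ C·n^{2/3}·log n`. -/
theorem medium_primes_higher_degree_contribution :
    ∃ C > 0, ∀ n : ℕ, 2 ≤ n →
      |∑ p ∈ (Finset.range (2 * n + 1)).filter
            (fun p : ℕ => p.Prime ∧ (n : ℝ) ^ ((2 : ℝ) / 3) ≤ (p : ℝ)),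
          ((padicValNat p ((Finset.Icc 1 n).lcm (fun i => i ^ 2 + 1)) : ℝ)
            - (if p % 4 = 1 then (1 : ℝ) else 0)
            - (padicValNat p (∏ i ∈ Finset.Icc 1 n, (i ^ 2 + 1)) : ℝ)
            + (if p % 4 = 1
                then (((Finset.Icc 1 n).filter (fun i => p ∣ i ^ 2 + 1)).card : ℝ)
                else 0)) * Real.log p|
      ≤ C * (n : ℝ) ^ ((2 : ℝ) / 3) * Real.log n := by
  refine ⟨144, by norm_num, fun n hn => ?_⟩
  have hn0 : (0 : ℝ) < n := by exact_mod_cast (by omega : 0 < n)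
  have hn1 : (1 : ℝ) ≤ n := by exact_mod_cast (by omega : 1 ≤ n)
  set x : ℝ := (n : ℝ) ^ ((1 : ℝ) / 3) with hx
  have hx1 : 1 ≤ x := Real.one_le_rpow hn1 (by norm_num)
  have hxn : x ^ 3 = n := by
    rw [hx, ← Real.rpow_natCast, ← Real.rpow_mul hn0.le]
    norm_num
  have hx2 : (n : ℝ) ^ ((2 : ℝ) / 3) = x ^ 2 := by
    rw [hx, ← Real.rpow_natCast, ← Real.rpow_mul hn0.le]
    norm_num
  rw [hx2]
  set S := (Finset.range (2 * n + 1)).filter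
    (fun p : ℕ => p.Prime ∧ x ^ 2 ≤ (p : ℝ)) with hS
  have hmem : ∀ p ∈ S, p.Prime ∧ p ≤ 2 * n ∧ n ^ 2 ≤ p ^ 3 := by
    intro p hp
    obtain ⟨h₁, h₂, h₃⟩ := Finset.mem_filter.1 hp
    refine ⟨h₂, by simpa [Nat.lt_succ_iff] using h₁, ?_⟩
    have : ((n : ℝ)) ^ 2 ≤ (p : ℝ) ^ 3 := by
      calc ((n : ℝ)) ^ 2 = (x ^ 2) ^ 3 := by rw [← hxn]; ring
        _ ≤ _ := by gcongr
    exact_mod_cast this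
  have hcard := card_sigma_sq_dvd_le (by omega) hx1 hxn S fun p hp => (hmem p hp).2
  rw [Finset.card_sigma, Nat.cast_sum] at hcard
  have hlogn : 0 ≤ Real.log n := Real.log_nonneg hn1
  have hlog2n : Real.log (2 * n : ℕ) ≤ 2 * Real.log n := by
    push_cast
    rw [Real.log_mul (by norm_num) hn0.ne']
    have := Real.log_le_log (by norm_num) (show (2 : ℝ) ≤ n by exact_mod_cast hn)
    linarith
  refine (Finset.abs_sum_le_sum_abs _ _).trans ?_
  calc _ ≤ ∑ p ∈ S, (((Finset.Icc 1 n).filter fun i => p ^ 2 ∣ i ^ 2 + 1).card : ℝ) *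
        (4 * Real.log n) := ?_
    _ = (∑ p ∈ S, (((Finset.Icc 1 n).filter fun i => p ^ 2 ∣ i ^ 2 + 1).card : ℝ)) *
        (4 * Real.log n) := by rw [Finset.sum_mul]
    _ ≤ 18 * x ^ 2 * (4 * Real.log n) := by gcongr
    _ ≤ 144 * x ^ 2 * Real.log n := by nlinarith [mul_nonneg (sq_nonneg x) hlogn]
  refine Finset.sum_le_sum fun p hp => ?_
  obtain ⟨hpp, hp2, hp3⟩ := hmem p hp
  have hlogp : 0 ≤ Real.log p := Real.log_nonneg (by exact_mod_cast hpp.one_lt.le)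
  have hlogp' : Real.log p ≤ 2 * Real.log n :=
    (Real.log_le_log (by exact_mod_cast hpp.pos) (by exact_mod_cast hp2)).trans hlog2n
  rw [abs_mul, abs_of_nonneg hlogp]
  have := abs_medium_prime_term_le hpp hn hp2 hp3
  calc _ ≤ 2 * (((Finset.Icc 1 n).filter fun i => p ^ 2 ∣ i ^ 2 + 1).card : ℝ) *
        (2 * Real.log n) := by gcongr
    _ = _ := by ring
end

section
/- There exists a constant C > 0 such that for all integers n ≥ 2, |Σ_{n^{2/3} ≤ p ≤ 2n, p prime, p ≡ 1 (mod 4)} log p − n| ≤ C·n/(log n). -/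
section HurwitzBound

open Complex Set

/-- The `n`-th Euler–Maclaurin remainder term of the Hurwitz zeta function. -/
noncomputable def hurwitzTerm (a : ℝ) (n : ℕ) (s : ℂ) : ℂ :=
  ((n + a : ℝ) : ℂ) ^ (-s) -
    (((n + a + 1 : ℝ) : ℂ) ^ (-s + 1) / (-s + 1) - ((n + a : ℝ) : ℂ) ^ (-s + 1) / (-s + 1))

lemma norm_cpow_neg_sub_le {w : ℝ} (hw : 0 < w) {s : ℂ} (hs : 0 < s.re) {u : ℝ}
    (hu : u ∈ Icc w (w + 1)) :
    ‖(w : ℂ) ^ (-s) - (u : ℂ) ^ (-s)‖ ≤ ‖s‖ * w ^ (-s.re - 1) := by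
  have hs0 : s ≠ 0 := by rintro rfl; simp at hs
  have key := norm_image_sub_le_of_norm_deriv_le_segment' (a := w) (b := w + 1)
    (f := fun y : ℝ ↦ (y : ℂ) ^ (-s - 1 + 1) / (-s - 1 + 1)) (f' := fun y : ℝ ↦ (y : ℂ) ^ (-s - 1))
    (C := w ^ (-s.re - 1)) ?_ ?_ u hu
  · have h1 : -s - 1 + 1 = -s := by ring
    simp only [h1] at key
    have h2 : (w : ℂ) ^ (-s) - (u : ℂ) ^ (-s)
        = s * ((u : ℂ) ^ (-s) / (-s) - (w : ℂ) ^ (-s) / (-s)) := by field_simp; ring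
    rw [h2, norm_mul]
    gcongr
    refine key.trans ?_
    have : u - w ≤ 1 := by linarith [hu.2]
    exact mul_le_of_le_one_right (by positivity) this
  · intro y hy
    have hy0 : y ≠ 0 := (hw.trans_le hy.1).ne'
    refine (hasDerivAt_ofReal_cpow_const' hy0 ?_).hasDerivWithinAt
    intro h
    apply hs0
    linear_combination -h
  · intro y hy
    have hy0 : 0 < y := hw.trans_le hy.1
    rw [norm_cpow_eq_rpow_re_of_pos hy0]
    exact Real.rpow_le_rpow_of_nonpos hw hy.1 (by simp; linarith)

lemma norm_cpow_neg_sub_le' {w : ℝ} (hw : 0 < w) {s : ℂ} (hs : 0 < s.re) {u : ℝ}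
    (hu : u ∈ Icc w (w + 1)) :
    ‖(w : ℂ) ^ (-s) - (u : ℂ) ^ (-s)‖ ≤ 2 * w ^ (-s.re) := by
  refine (norm_sub_le _ _).trans ?_
  rw [norm_cpow_eq_rpow_re_of_pos hw, norm_cpow_eq_rpow_re_of_pos (hw.trans_le hu.1)]
  have := Real.rpow_le_rpow_of_nonpos hw hu.1 (z := (-s).re) (by simp; linarith)
  simp only [neg_re] at *
  linarith

lemma norm_hurwitzTerm_le {a : ℝ} (ha : 0 < a) (n : ℕ) {s : ℂ} (hs : 0 < s.re) (hs1 : s ≠ 1)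
    {θ : ℝ} (hθ : 0 ≤ θ) (hθ1 : θ ≤ 1) :
    ‖hurwitzTerm a n s‖ ≤ 2 * ‖s‖ ^ θ * (n + a) ^ (-(s.re + θ)) := by
  set w : ℝ := n + a with hw_def
  have hw : 0 < w := by positivity
  have hbd : ∀ u ∈ Ico w (w + 1), ‖(w : ℂ) ^ (-s) - (u : ℂ) ^ (-s)‖
      ≤ 2 * ‖s‖ ^ θ * w ^ (-(s.re + θ)) := by
    intro u hu
    have hu' := Ico_subset_Icc_self hu
    set X := ‖(w : ℂ) ^ (-s) - (u : ℂ) ^ (-s)‖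
    have hX : 0 ≤ X := norm_nonneg _
    calc X = X ^ (1 - θ) * X ^ θ := by
          rw [← Real.rpow_add' hX (by norm_num)]; simp
      _ ≤ (2 * w ^ (-s.re)) ^ (1 - θ) * (‖s‖ * w ^ (-s.re - 1)) ^ θ := by
          gcongr
          · exact norm_cpow_neg_sub_le' hw hs hu'
          · exact norm_cpow_neg_sub_le hw hs hu'
      _ = 2 ^ (1 - θ) * ‖s‖ ^ θ * w ^ (-(s.re + θ)) := by
          rw [Real.mul_rpow (by norm_num) (by positivity), Real.mul_rpow (by positivity)
            (by positivity), ← Real.rpow_mul hw.le, ← Real.rpow_mul hw.le]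
          have : -(s.re + θ) = -s.re * (1 - θ) + (-s.re - 1) * θ := by ring
          rw [this, Real.rpow_add hw]
          ring
      _ ≤ 2 * ‖s‖ ^ θ * w ^ (-(s.re + θ)) := by
          gcongr
          calc (2 : ℝ) ^ (1 - θ) ≤ 2 ^ (1 : ℝ) :=
                Real.rpow_le_rpow_of_exponent_le (by norm_num) (by linarith)
            _ = 2 := by simp
  have key := norm_image_sub_le_of_norm_deriv_le_segment' (a := w) (b := w + 1)
    (f := fun y : ℝ ↦ (y : ℂ) * (w : ℂ) ^ (-s) - (y : ℂ) ^ (-s + 1) / (-s + 1))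
    (f' := fun y : ℝ ↦ (w : ℂ) ^ (-s) - (y : ℂ) ^ (-s))
    (C := 2 * ‖s‖ ^ θ * w ^ (-(s.re + θ))) ?_ hbd (w + 1) (by simp)
  · refine le_trans (le_of_eq ?_) (key.trans (by simp))
    congr 1
    simp only [hurwitzTerm, ← hw_def]
    push_cast
    ring
  · intro y hy
    have hy0 : y ≠ 0 := (hw.trans_le hy.1).ne'
    have h1 := hasDerivAt_ofReal_cpow_const' hy0 (r := -s) (by
      intro h; apply hs1; linear_combination -h)
    have h2 : HasDerivAt (fun y : ℝ ↦ (y : ℂ) * (w : ℂ) ^ (-s)) ((w : ℂ) ^ (-s)) y := by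
      simpa using (ofRealCLM.hasDerivAt (x := y)).mul_const ((w : ℂ) ^ (-s))
    exact (h2.sub h1).hasDerivWithinAt

lemma norm_hurwitzTerm_le_of_re_mem {a : ℝ} (ha : 0 < a) (ha1 : a ≤ 1) (n : ℕ) {s : ℂ}
    (hs : 39 / 40 ≤ s.re) (hs4 : s.re ≤ 4) (hs1 : s ≠ 1) :
    ‖hurwitzTerm a n s‖ ≤
      ‖s‖ ^ (1 / 20 : ℝ) * (2 * a ^ (-5 : ℝ) * ((n + 1 : ℕ) : ℝ) ^ (-(41 / 40) : ℝ)) := by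
  refine (norm_hurwitzTerm_le ha n (by linarith) hs1 (θ := 1 / 20) (by norm_num)
    (by norm_num)).trans ?_
  have h1 : (n + a : ℝ) ^ (-(s.re + 1 / 20)) ≤ (a * ((n + 1 : ℕ) : ℝ)) ^ (-(s.re + 1 / 20)) := by
    refine Real.rpow_le_rpow_of_nonpos (by positivity) ?_ (by linarith)
    push_cast
    nlinarith [mul_le_mul_of_nonneg_right ha1 (Nat.cast_nonneg (α := ℝ) n)]
  have h2 : a ^ (-(s.re + 1 / 20)) ≤ a ^ (-5 : ℝ) :=
    Real.rpow_le_rpow_of_exponent_ge ha ha1 (by linarith)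
  have h3 : ((n + 1 : ℕ) : ℝ) ^ (-(s.re + 1 / 20)) ≤ ((n + 1 : ℕ) : ℝ) ^ (-(41 / 40) : ℝ) :=
    Real.rpow_le_rpow_of_exponent_le (by simp) (by linarith)
  rw [Real.mul_rpow ha.le (by positivity)] at h1
  calc _ ≤ 2 * ‖s‖ ^ (1 / 20 : ℝ) *
        (a ^ (-5 : ℝ) * ((n + 1 : ℕ) : ℝ) ^ (-(41 / 40) : ℝ)) := by
          gcongr
          exact h1.trans (by gcongr)
    _ = _ := by ring

lemma summable_hurwitz_bound (a : ℝ) :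
    Summable fun n : ℕ ↦ 2 * a ^ (-5 : ℝ) * ((n + 1 : ℕ) : ℝ) ^ (-(41 / 40) : ℝ) :=
  (((summable_nat_add_iff 1).mpr (Real.summable_nat_rpow.mpr (by norm_num :
    (-(41 / 40) : ℝ) < -1)))).mul_left _

lemma hasSum_hurwitzTerm {a : ℝ} (ha : 0 < a) (ha1 : a ≤ 1) {s : ℂ} (hs : 1 < s.re)
    (hs4 : s.re ≤ 4) :
    HasSum (fun n ↦ hurwitzTerm a n s)
      (HurwitzZeta.hurwitzZeta a s + (a : ℂ) ^ (-s + 1) / (-s + 1)) := by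
  have h1 := HurwitzZeta.hasSum_hurwitzZeta_of_one_lt_re (a := a) ⟨ha.le, ha1⟩ hs
  have h1' : HasSum (fun n : ℕ ↦ ((n + a : ℝ) : ℂ) ^ (-s)) (HurwitzZeta.hurwitzZeta a s) := by
    refine h1.congr_fun ?_
    intro n
    rw [cpow_neg]; push_cast; simp
  have hs0 : -s + 1 ≠ 0 := by
    intro h
    have : s = 1 := by linear_combination -h
    simp [this] at hs
  have h2 : Filter.Tendsto (fun n : ℕ ↦ ((n + a : ℝ) : ℂ) ^ (-s + 1) / (-s + 1)) Filter.atTop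
      (nhds 0) := by
    rw [show (0 : ℂ) = 0 / (-s + 1) by simp]
    refine Filter.Tendsto.div_const ?_ _
    rw [tendsto_zero_iff_norm_tendsto_zero]
    have : ∀ n : ℕ, ‖((n + a : ℝ) : ℂ) ^ (-s + 1)‖ = ((n : ℝ) + a) ^ (-(s.re - 1)) := by
      intro n
      rw [norm_cpow_eq_rpow_re_of_pos (by positivity)]
      congr 1
      simp; ring
    simp_rw [this]
    exact (tendsto_rpow_neg_atTop (by linarith)).comp
      (Filter.tendsto_atTop_add_const_right _ a tendsto_natCast_atTop_atTop)
  have hsum : Summable (fun n ↦ hurwitzTerm a n s) := by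
    exact Summable.of_norm_bounded ((summable_hurwitz_bound a).mul_left _) fun n ↦
      norm_hurwitzTerm_le_of_re_mem ha ha1 n (by linarith) hs4 (by rintro rfl; simp at hs)
  rw [hsum.hasSum_iff_tendsto_nat]
  have h3 := h1'.tendsto_sum_nat.sub (h2.sub_const ((((0 : ℕ) + a : ℝ) : ℂ) ^ (-s + 1) / (-s + 1)))
  convert h3 using 2 with n
  · rw [← Finset.sum_range_sub (fun n : ℕ ↦ ((n + a : ℝ) : ℂ) ^ (-s + 1) / (-s + 1)), ← Finset.sum_sub_distrib]
    refine Finset.sum_congr rfl fun k _ ↦ ?_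
    simp only [hurwitzTerm]
    push_cast
    rw [add_right_comm]
  · simp

lemma differentiableAt_hurwitzTerm {a : ℝ} (ha : 0 < a) (n : ℕ) {s : ℂ} (hs : s ≠ 1) :
    DifferentiableAt ℂ (hurwitzTerm a n) s := by
  have h1 : ((n + a : ℝ) : ℂ) ≠ 0 := by exact_mod_cast (by positivity : (n + a : ℝ) ≠ 0)
  have h2 : ((n + a + 1 : ℝ) : ℂ) ≠ 0 := by exact_mod_cast (by positivity : (n + a + 1 : ℝ) ≠ 0)
  have h3 : -s + 1 ≠ 0 := fun h ↦ hs (by linear_combination -h)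
  unfold hurwitzTerm
  refine DifferentiableAt.sub ?_ (DifferentiableAt.sub ?_ ?_)
  · exact (differentiableAt_id.neg).const_cpow (.inl h1)
  · exact ((differentiableAt_id.neg.add_const _).const_cpow (.inl h2)).div
      (differentiableAt_id.neg.add_const _) h3
  · exact ((differentiableAt_id.neg.add_const _).const_cpow (.inl h1)).div
      (differentiableAt_id.neg.add_const _) h3

lemma hurwitzZeta_eq_tsum {a : ℝ} (ha : 0 < a) (ha1 : a ≤ 1) {s : ℂ} (hs : 39 / 40 < s.re)
    (hs4 : s.re < 4) (him : s.im ≠ 0) :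
    HurwitzZeta.hurwitzZeta a s = ∑' n, hurwitzTerm a n s - (a : ℂ) ^ (-s + 1) / (-s + 1) := by
  obtain ⟨c, hc, hcs⟩ : ∃ c : ℝ, c ^ 2 = 1 ∧ 0 < c * s.im := by
    rcases lt_or_gt_of_ne him with h | h
    · exact ⟨-1, by norm_num, by linarith⟩
    · exact ⟨1, by norm_num, by linarith⟩
  have hc0 : c ≠ 0 := by rintro rfl; simp at hc
  set R := c * s.im + 1
  set U : Set ℂ := re ⁻¹' (Ioo (39 / 40) 4) ∩ im ⁻¹' ((fun y ↦ c * y) ⁻¹' (Ioo 0 R)) with hU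
  have hUo : IsOpen U := (isOpen_Ioo.preimage continuous_re).inter
    ((isOpen_Ioo.preimage (by fun_prop)).preimage continuous_im)
  have hUc : Convex ℝ U := by
    refine ((convex_Ioo _ _).linear_preimage reLm).inter (Convex.linear_preimage ?_ imLm)
    exact (convex_Ioo 0 R).linear_preimage (LinearMap.mulLeft ℝ c)
  have hU1 : ∀ z ∈ U, z ≠ 1 := by
    rintro z hz rfl
    have := hz.2.1
    simp at this
  have hUn : ∀ z ∈ U, ‖z‖ ≤ 4 + R := by
    intro z hz
    refine (norm_le_abs_re_add_abs_im z).trans (add_le_add ?_ ?_)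
    · rw [abs_of_pos (by linarith [hz.1.1])]; exact hz.1.2.le
    · have h := hz.2
      simp only [mem_preimage, mem_Ioo] at h
      have : |z.im| = c * z.im := by
        rw [← abs_of_pos h.1, abs_mul]
        have : |c| = 1 := by rwa [← sq_eq_sq₀ (abs_nonneg _) zero_le_one, sq_abs, one_pow]
        rw [this, one_mul]
      rw [this]; exact h.2.le
  have hd1 : DifferentiableOn ℂ (fun z ↦ HurwitzZeta.hurwitzZeta a z) U := fun z hz ↦
    (HurwitzZeta.differentiableAt_hurwitzZeta a (hU1 z hz)).differentiableWithinAt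
  have hd2 : DifferentiableOn ℂ
      (fun z ↦ ∑' n, hurwitzTerm a n z - (a : ℂ) ^ (-z + 1) / (-z + 1)) U := by
    refine DifferentiableOn.sub ?_ ?_
    · refine differentiableOn_tsum_of_summable_norm
        (((summable_hurwitz_bound a).mul_left ((4 + R) ^ (1 / 20 : ℝ)))) ?_ hUo ?_
      · exact fun n z hz ↦ (differentiableAt_hurwitzTerm ha n (hU1 z hz)).differentiableWithinAt
      · intro n z hz
        refine (norm_hurwitzTerm_le_of_re_mem ha ha1 n hz.1.1.le hz.1.2.le (hU1 z hz)).trans ?_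
        gcongr
        exact hUn z hz
    · intro z hz
      have h1 : (a : ℂ) ≠ 0 := by exact_mod_cast ha.ne'
      exact (((differentiableAt_id.neg.add_const _).const_cpow (.inl h1)).div
        (differentiableAt_id.neg.add_const _)
        (show -z + 1 ≠ 0 from fun h ↦ hU1 z hz (by linear_combination -h))).differentiableWithinAt
  have hsU : s ∈ U := ⟨⟨hs, hs4⟩, by simp [R, hcs]⟩
  set z₀ : ℂ := ⟨2, s.im⟩
  have hz₀ : z₀ ∈ U := ⟨by constructor <;> norm_num [z₀], by simp [R, z₀, hcs]⟩
  refine AnalyticOnNhd.eqOn_of_preconnected_of_eventuallyEq (hd1.analyticOnNhd hUo)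
    (hd2.analyticOnNhd hUo) hUc.isPreconnected hz₀ ?_ hsU
  have hev : ∀ᶠ z : ℂ in nhds z₀, z.re ∈ Ioo 1 4 :=
    (isOpen_Ioo.preimage continuous_re).mem_nhds (by constructor <;> norm_num [z₀])
  filter_upwards [hev] with z hz
  rw [(hasSum_hurwitzTerm ha ha1 hz.1 hz.2.le).tsum_eq]
  ring

lemma exists_norm_hurwitzZeta_le {a : ℝ} (ha : 0 < a) (ha1 : a ≤ 1) :
    ∃ C : ℝ, 0 < C ∧ ∀ s : ℂ, 39 / 40 < s.re → s.re < 4 → 1 ≤ |s.im| →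
      ‖HurwitzZeta.hurwitzZeta a s‖ ≤ C * |s.im| ^ (1 / 20 : ℝ) := by
  set S := ∑' n : ℕ, 2 * a ^ (-5 : ℝ) * ((n + 1 : ℕ) : ℝ) ^ (-(41 / 40) : ℝ) with hS
  have hS0 : 0 ≤ S := tsum_nonneg fun n ↦ by positivity
  refine ⟨5 * S + a ^ (-3 : ℝ), by positivity, fun s hs hs4 him ↦ ?_⟩
  have him0 : s.im ≠ 0 := by rintro h; simp [h] at him; linarith
  have hs1 : s ≠ 1 := by rintro rfl; simp at him0
  rw [hurwitzZeta_eq_tsum ha ha1 hs hs4 him0, add_mul]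
  refine (norm_sub_le _ _).trans (add_le_add ?_ ?_)
  · have h1 : ‖∑' n, hurwitzTerm a n s‖ ≤ ‖s‖ ^ (1 / 20 : ℝ) * S := by
      refine tsum_of_norm_bounded ((summable_hurwitz_bound a).hasSum.mul_left _) fun n ↦
        norm_hurwitzTerm_le_of_re_mem ha ha1 n hs.le hs4.le hs1
    have h2 : ‖s‖ ≤ 5 * |s.im| := by
      refine (norm_le_abs_re_add_abs_im s).trans ?_
      rw [abs_of_pos (by linarith : 0 < s.re)]
      linarith
    have h3 : ‖s‖ ^ (1 / 20 : ℝ) ≤ 5 * |s.im| ^ (1 / 20 : ℝ) := by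
      calc ‖s‖ ^ (1 / 20 : ℝ) ≤ (5 * |s.im|) ^ (1 / 20 : ℝ) := by gcongr
        _ = 5 ^ (1 / 20 : ℝ) * |s.im| ^ (1 / 20 : ℝ) := Real.mul_rpow (by norm_num) (by positivity)
        _ ≤ 5 ^ (1 : ℝ) * |s.im| ^ (1 / 20 : ℝ) := by gcongr <;> norm_num
        _ = _ := by simp
    calc _ ≤ _ := h1
      _ ≤ 5 * |s.im| ^ (1 / 20 : ℝ) * S := by gcongr
      _ = _ := by ring
  · rw [norm_div, norm_cpow_eq_rpow_re_of_pos ha]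
    have h1 : 1 ≤ ‖-s + 1‖ := him.trans (by simpa using abs_im_le_norm (-s + 1))
    have h2 : 1 ≤ |s.im| ^ (1 / 20 : ℝ) := Real.one_le_rpow him (by norm_num)
    calc a ^ (-s + 1).re / ‖-s + 1‖ ≤ a ^ (-s + 1).re := div_le_self (by positivity) h1
      _ ≤ a ^ (-3 : ℝ) := Real.rpow_le_rpow_of_exponent_ge ha ha1 (by simp; linarith)
      _ ≤ _ := le_mul_of_one_le_right (by positivity) h2

lemma exists_norm_LFunction_le {q : ℕ} [NeZero q] (χ : DirichletCharacter ℂ q) :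
    ∃ C : ℝ, 0 < C ∧ ∀ s : ℂ, 39 / 40 < s.re → s.re < 4 → 1 ≤ |s.im| →
      ‖DirichletCharacter.LFunction χ s‖ ≤ C * |s.im| ^ (1 / 20 : ℝ) := by
  have h : ∀ j : ZMod q, ∃ C : ℝ, 0 < C ∧ ∀ s : ℂ, 39 / 40 < s.re → s.re < 4 → 1 ≤ |s.im| →
      ‖HurwitzZeta.hurwitzZeta (ZMod.toAddCircle j) s‖ ≤ C * |s.im| ^ (1 / 20 : ℝ) := by
    intro j
    have hq : (0 : ℝ) < q := by exact_mod_cast Nat.pos_of_neZero q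
    rcases Nat.eq_zero_or_pos j.val with hj | hj
    · have : j = 0 := by simpa using hj
      have h1 : ZMod.toAddCircle j = ((1 : ℝ) : UnitAddCircle) := by
        rw [this, map_zero]; exact (AddCircle.coe_period (1 : ℝ)).symm
      rw [h1]
      exact exists_norm_hurwitzZeta_le one_pos le_rfl
    · rw [ZMod.toAddCircle_apply]
      refine exists_norm_hurwitzZeta_le (by positivity) ?_
      rw [div_le_one hq]
      exact_mod_cast (ZMod.val_lt j).le
  choose C hC0 hC using h
  refine ⟨∑ j, C j, Finset.sum_pos (fun j _ ↦ hC0 j) Finset.univ_nonempty, fun s hs hs4 him ↦ ?_⟩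
  rw [DirichletCharacter.LFunction, ZMod.LFunction, norm_mul, Finset.sum_mul]
  have h1 : ‖(q : ℂ) ^ (-s)‖ ≤ 1 := by
    rw [norm_natCast_cpow_of_pos (Nat.pos_of_neZero q)]
    exact Real.rpow_le_one_of_one_le_of_nonpos (by exact_mod_cast Nat.pos_of_neZero q)
      (by simp; linarith)
  refine (mul_le_of_le_one_left (norm_nonneg _) h1).trans ?_
  refine norm_sum_le_of_le _ fun j _ ↦ ?_
  rw [norm_mul]
  exact (mul_le_of_le_one_left (norm_nonneg _) (χ.norm_le_one j)).trans (hC j s hs hs4 him)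

end HurwitzBound

section LogDerivBound

open Complex Set DirichletCharacter

lemma exists_norm_LFunctionTrivChar_le (q : ℕ) [NeZero q] :
    ∃ C : ℝ, 0 < C ∧ ∀ x : ℝ, 0 < x → x ≤ 2 → ‖LFunctionTrivChar q (1 + x)‖ ≤ C / x := by
  have hcont : Continuous fun x : ℝ ↦ LFunctionTrivChar₁ q (1 + x) :=
    (differentiable_LFunctionTrivChar₁ q).continuous.comp (by fun_prop)
  obtain ⟨C, hC⟩ := (isCompact_Icc (a := (0 : ℝ)) (b := 2)).exists_bound_of_continuousOn
    hcont.continuousOn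
  refine ⟨max C 1, by positivity, fun x hx hx2 ↦ ?_⟩
  have h := hC x ⟨hx.le, hx2⟩
  have hne : (1 + x : ℂ) ≠ 1 := by simpa using hx.ne'
  rw [LFunctionTrivChar₁, Function.update_of_ne hne, norm_mul, add_sub_cancel_left, norm_real,
    Real.norm_of_nonneg hx.le] at h
  rw [le_div_iff₀ hx, mul_comm]
  exact h.trans (le_max_left _ _)

lemma rpow_abs_le_two_mul {u v : ℝ} (h : |u| ≤ 2 * |v|) :
    |u| ^ (1 / 20 : ℝ) ≤ 2 * |v| ^ (1 / 20 : ℝ) := by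
  calc |u| ^ (1 / 20 : ℝ) ≤ (2 * |v|) ^ (1 / 20 : ℝ) := by gcongr
    _ = 2 ^ (1 / 20 : ℝ) * |v| ^ (1 / 20 : ℝ) := Real.mul_rpow (by norm_num) (by positivity)
    _ ≤ 2 ^ (1 : ℝ) * |v| ^ (1 / 20 : ℝ) := by gcongr <;> norm_num
    _ = _ := by simp

lemma exists_pow_three_le {q : ℕ} [NeZero q] (χ : DirichletCharacter ℂ q) :
    ∃ M : ℝ, 0 < M ∧ ∀ x t : ℝ, 0 < x → x ≤ 2 → 1 ≤ |t| →
      x ^ 3 ≤ M * |t| ^ (1 / 20 : ℝ) * ‖LFunction χ (1 + x + I * t)‖ ^ 4 := by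
  obtain ⟨C, hC0, hC⟩ := exists_norm_LFunctionTrivChar_le q
  obtain ⟨D, hD0, hD⟩ := exists_norm_LFunction_le (χ ^ 2)
  refine ⟨C ^ 3 * (2 * D), by positivity, fun x t hx hx2 ht ↦ ?_⟩
  have h := norm_LFunction_product_ge_one χ hx t
  rw [norm_mul, norm_mul, norm_pow, norm_pow] at h
  have h1 := hC x hx hx2
  have h2 : ‖LFunction (χ ^ 2) (1 + x + 2 * I * t)‖ ≤ D * (2 * |t| ^ (1 / 20 : ℝ)) := by
    have him : (1 + x + 2 * I * t : ℂ).im = 2 * t := by simp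
    have hre : (1 + x + 2 * I * t : ℂ).re = 1 + x := by simp
    refine (hD _ (by rw [hre]; linarith) (by rw [hre]; linarith) ?_).trans ?_
    · rw [him, abs_mul, abs_two]; linarith
    · rw [him]
      gcongr
      exact rpow_abs_le_two_mul (by rw [abs_mul, abs_two])
  set B := ‖LFunction χ (1 + x + I * t)‖
  have h3 : 1 ≤ (C / x) ^ 3 * B ^ 4 * (D * (2 * |t| ^ (1 / 20 : ℝ))) :=
    h.le.trans (by gcongr)
  rw [div_pow, div_mul_eq_mul_div, div_mul_eq_mul_div, le_div_iff₀ (by positivity)] at h3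
  linarith

lemma exists_norm_deriv_LFunction_le {q : ℕ} [NeZero q] (χ : DirichletCharacter ℂ q) :
    ∃ D : ℝ, 0 < D ∧ ∀ s : ℂ, 79 / 80 ≤ s.re → s.re ≤ 7 / 2 → 2 ≤ |s.im| →
      ‖deriv (LFunction χ) s‖ ≤ D * |s.im| ^ (1 / 20 : ℝ) := by
  obtain ⟨C, hC0, hC⟩ := exists_norm_LFunction_le χ
  refine ⟨C * 2 / (1 / 100), by positivity, fun s hs hs4 him ↦ ?_⟩
  have hz : ∀ z ∈ Metric.closedBall s (1 / 100), |z.re - s.re| ≤ 1 / 100 ∧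
      |z.im - s.im| ≤ 1 / 100 := by
    intro z hz
    rw [Metric.mem_closedBall, dist_eq_norm] at hz
    exact ⟨(abs_re_le_norm (z - s)).trans hz, (abs_im_le_norm (z - s)).trans hz⟩
  have hz1 : ∀ z ∈ Metric.closedBall s (1 / 100), 1 ≤ |z.im| ∧ |z.im| ≤ 2 * |s.im| := by
    intro z hz'
    have h1 := (hz z hz').2
    have h2 := abs_sub_abs_le_abs_sub s.im z.im
    have h3 := abs_sub_abs_le_abs_sub z.im s.im
    rw [abs_sub_comm] at h2
    constructor <;> linarith
  have hd : DifferentiableOn ℂ (LFunction χ) (Metric.closedBall s (1 / 100)) := fun z hz' ↦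
    (differentiableAt_LFunction χ z (.inl (by
      rintro rfl
      have := (hz1 1 hz').1
      simp at this; linarith))).differentiableWithinAt
  have := norm_deriv_le_of_forall_mem_sphere_norm_le (f := LFunction χ) (c := s) (R := 1 / 100)
    (C := C * (2 * |s.im| ^ (1 / 20 : ℝ))) (by norm_num) ?_ ?_
  · refine this.trans (le_of_eq ?_)
    ring
  · refine DifferentiableOn.diffContOnCl ?_
    rwa [closure_ball _ (by norm_num)]
  · intro z hz'
    have hzb := Metric.sphere_subset_closedBall hz'
    have h1 := abs_le.mp (hz z hzb).1
    refine (hC z (by linarith) (by linarith) (hz1 z hzb).1).trans ?_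
    gcongr
    exact rpow_abs_le_two_mul (hz1 z hzb).2

lemma exists_le_norm_LFunction {q : ℕ} [NeZero q] (χ : DirichletCharacter ℂ q) :
    ∃ κ c : ℝ, 0 < κ ∧ κ ≤ 1 / 100 ∧ 0 < c ∧ ∀ s : ℂ, 2 ≤ |s.im| →
      1 - κ / (|s.im| ^ (1 / 20 : ℝ)) ^ 5 ≤ s.re → s.re ≤ 3 →
      c / (|s.im| ^ (1 / 20 : ℝ)) ^ 4 ≤ ‖LFunction χ s‖ := by
  obtain ⟨M, hM0, hM⟩ := exists_pow_three_le χ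
  obtain ⟨D, hD0, hD⟩ := exists_norm_deriv_LFunction_le χ
  set κ := min (1 / 100) (1 / (256 * D ^ 4 * M)) with hκ_def
  have hκ0 : 0 < κ := by positivity
  have hκ1 : κ ≤ 1 / 100 := min_le_left _ _
  have hκ2 : (4 * κ * D) ^ 4 ≤ κ ^ 3 / M := by
    have : κ ≤ 1 / (256 * D ^ 4 * M) := min_le_right _ _
    rw [le_div_iff₀ (by positivity)] at this ⊢
    calc (4 * κ * D) ^ 4 * M = κ ^ 3 * (κ * (256 * D ^ 4 * M)) := by ring
      _ ≤ κ ^ 3 * 1 := by gcongr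
      _ = κ ^ 3 := mul_one _
  refine ⟨κ, 2 * κ * D, hκ0, hκ1, by positivity, fun s him hs hs3 ↦ ?_⟩
  set T := |s.im| ^ (1 / 20 : ℝ) with hT_def
  have hT1 : 1 ≤ T := Real.one_le_rpow (by linarith) (by norm_num)
  have hT0 : 0 < T := by linarith
  set x₀ := κ / T ^ 5 with hx₀_def
  have hx₀ : 0 < x₀ := by positivity
  have hx₀' : x₀ ≤ 1 / 100 := (div_le_self hκ0.le (one_le_pow₀ hT1)).trans hκ1
  set x := max (s.re - 1) x₀ with hx_def
  have hx0 : 0 < x := lt_max_of_lt_right hx₀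
  have hx2 : x ≤ 2 := max_le (by linarith) (by linarith)
  have hxs : s.re - 1 ≤ x := le_max_left _ _
  have hxx₀ : x₀ ≤ x := le_max_right _ _
  have hxs' : x - (s.re - 1) ≤ 2 * x₀ := by
    have : x ≤ s.re - 1 + 2 * x₀ := max_le (by linarith) (by linarith)
    linarith
  set s' : ℂ := 1 + x + I * s.im with hs'_def
  have hs're : s'.re = 1 + x := by simp [s']
  have hs'im : s'.im = s.im := by simp [s']
  have hlow : 4 * κ * D / T ^ 4 ≤ ‖LFunction χ s'‖ := by
    have h := hM x s.im hx0 hx2 (by linarith)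
    rw [div_le_iff₀ (by positivity)]
    refine le_of_pow_le_pow_left₀ (n := 4) (by norm_num) (by positivity) ?_
    refine hκ2.trans ?_
    rw [div_le_iff₀ hM0]
    have h1 : x₀ ^ 3 ≤ x ^ 3 := by gcongr
    rw [hx₀_def, div_pow, div_le_iff₀ (by positivity)] at h1
    calc κ ^ 3 ≤ x ^ 3 * (T ^ 5) ^ 3 := h1
      _ ≤ (M * T * ‖LFunction χ s'‖ ^ 4) * (T ^ 5) ^ 3 := by gcongr
      _ = _ := by ring
  have hseg : ∀ z ∈ segment ℝ s s', 79 / 80 ≤ z.re ∧ z.re ≤ 7 / 2 ∧ z.im = s.im := by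
    have hconv : Convex ℝ (re ⁻¹' (Icc (79 / 80) (7 / 2)) ∩ im ⁻¹' {s.im}) :=
      ((convex_Icc (79 / 80 : ℝ) (7 / 2)).linear_preimage reLm).inter
        ((convex_singleton s.im).linear_preimage imLm)
    have hsub := hconv.segment_subset (x := s) (y := s')
      ⟨⟨by linarith, by linarith⟩, rfl⟩ ⟨⟨by rw [hs're]; linarith, by rw [hs're]; linarith⟩, hs'im⟩
    exact fun z hz ↦ ⟨(hsub hz).1.1, (hsub hz).1.2, (hsub hz).2⟩
  have hdiff : ‖LFunction χ s' - LFunction χ s‖ ≤ D * T * ‖s' - s‖ := by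
    refine (convex_segment s s').norm_image_sub_le_of_norm_deriv_le ?_ ?_
      (left_mem_segment ℝ s s') (right_mem_segment ℝ s s')
    · intro z hz
      refine differentiableAt_LFunction χ z (.inl ?_)
      rintro rfl
      have := (hseg 1 hz).2.2
      rw [← this] at him
      simp at him; linarith
    · intro z hz
      obtain ⟨h1, h2, h3⟩ := hseg z hz
      have := hD z h1 h2 (by rw [h3]; exact him)
      rwa [h3] at this
  have hnorm : ‖s' - s‖ ≤ 2 * x₀ := by
    have : s' - s = ((x - (s.re - 1) : ℝ) : ℂ) := by
      apply Complex.ext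
      · simp [hs're]; ring
      · simp [hs'im]
    rw [this, norm_real, Real.norm_of_nonneg (by linarith)]
    exact hxs'
  have hfin : D * T * ‖s' - s‖ ≤ 2 * κ * D / T ^ 4 := by
    calc D * T * ‖s' - s‖ ≤ D * T * (2 * x₀) := by gcongr
      _ = _ := by rw [hx₀_def]; field_simp
  have htri := norm_sub_norm_le (LFunction χ s') (LFunction χ s)
  have : 4 * κ * D / T ^ 4 = 2 * κ * D / T ^ 4 + 2 * κ * D / T ^ 4 := by ring
  linarith

lemma exists_norm_logDeriv_LFunction_le {q : ℕ} [NeZero q] (χ : DirichletCharacter ℂ q) :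
    ∃ κ C : ℝ, 0 < κ ∧ κ ≤ 1 / 100 ∧ 0 < C ∧ ∀ s : ℂ, 2 ≤ |s.im| →
      1 - κ / (|s.im| ^ (1 / 20 : ℝ)) ^ 5 ≤ s.re → s.re ≤ 3 →
      LFunction χ s ≠ 0 ∧
      ‖deriv (LFunction χ) s / LFunction χ s‖ ≤ C * (|s.im| ^ (1 / 20 : ℝ)) ^ 5 := by
  obtain ⟨κ, c, hκ0, hκ1, hc, h⟩ := exists_le_norm_LFunction χ
  obtain ⟨D, hD0, hD⟩ := exists_norm_deriv_LFunction_le χ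
  refine ⟨κ, D / c, hκ0, hκ1, by positivity, fun s him hs hs3 ↦ ?_⟩
  have hlow := h s him hs hs3
  set T := |s.im| ^ (1 / 20 : ℝ) with hT_def
  have hT1 : 1 ≤ T := Real.one_le_rpow (by linarith) (by norm_num)
  have hT0 : 0 < T := by linarith
  have hx₀ : κ / T ^ 5 ≤ 1 / 100 := (div_le_self hκ0.le (one_le_pow₀ hT1)).trans hκ1
  have hpos : 0 < ‖LFunction χ s‖ := lt_of_lt_of_le (by positivity) hlow
  refine ⟨norm_pos_iff.mp hpos, ?_⟩
  rw [norm_div, div_le_iff₀ hpos]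
  calc ‖deriv (LFunction χ) s‖ ≤ D * T := hD s (by linarith) (by linarith) him
    _ = D / c * T ^ 5 * (c / T ^ 4) := by field_simp
    _ ≤ _ := by gcongr

end LogDerivBound

section ResidueClassAux

open Complex Set DirichletCharacter

open ArithmeticFunction.vonMangoldt

variable {q : ℕ} [NeZero q]

lemma analyticAt_LFunctionResidueClassAux (a : ZMod q) {s : ℂ}
    (h₁ : LFunctionTrivChar₁ q s ≠ 0)
    (h : ∀ χ : DirichletCharacter ℂ q, χ ≠ 1 → LFunction χ s ≠ 0) :
    AnalyticAt ℂ (LFunctionResidueClassAux a) s := by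
  classical
  have hL₁ : AnalyticAt ℂ (LFunctionTrivChar₁ q) s :=
    (differentiable_LFunctionTrivChar₁ q).analyticAt s
  refine analyticAt_const.mul ((hL₁.deriv.neg.div hL₁ h₁).sub ?_)
  refine Finset.analyticAt_fun_sum _ fun χ hχ ↦ ?_
  have hχ : χ ≠ 1 := by simpa using hχ
  have hL : AnalyticAt ℂ (LFunction χ) s := (differentiable_LFunction hχ).analyticAt s
  exact (analyticAt_const.mul hL.deriv).div hL (h χ hχ)

lemma LFunctionTrivChar₁_ne_zero_of {s : ℂ} (hs : s ≠ 1) (h : LFunctionTrivChar q s ≠ 0) :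
    LFunctionTrivChar₁ q s ≠ 0 := by
  rw [LFunctionTrivChar₁, Function.update_of_ne hs]
  exact mul_ne_zero (sub_ne_zero_of_ne hs) h

lemma analyticAt_LFunctionResidueClassAux_of_one_le_re (a : ZMod q) {s : ℂ} (hs : 1 ≤ s.re) :
    AnalyticAt ℂ (LFunctionResidueClassAux a) s := by
  refine analyticAt_LFunctionResidueClassAux a ?_
    fun χ hχ ↦ LFunction_ne_zero_of_one_le_re χ (.inl hχ) hs
  rcases eq_or_ne s 1 with rfl | hs₁
  · exact LFunctionTrivChar₁_apply_one_ne_zero q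
  · exact LFunctionTrivChar₁_ne_zero_of hs₁ (LFunction_ne_zero_of_one_le_re 1 (.inr hs₁) hs)

lemma exists_norm_LFunctionResidueClassAux_le (a : ZMod q) :
    ∃ κ C : ℝ, 0 < κ ∧ κ ≤ 1 / 100 ∧ 0 < C ∧ ∀ s : ℂ, 2 ≤ |s.im| →
      1 - κ / (|s.im| ^ (1 / 20 : ℝ)) ^ 5 ≤ s.re → s.re ≤ 3 →
      AnalyticAt ℂ (LFunctionResidueClassAux a) s ∧
        ‖LFunctionResidueClassAux a s‖ ≤ C * (|s.im| ^ (1 / 20 : ℝ)) ^ 5 := by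
  choose κ C hκ hκ' hC h using fun χ : DirichletCharacter ℂ q ↦ exists_norm_logDeriv_LFunction_le χ
  obtain ⟨χ₀, hχ₀⟩ := Finite.exists_min κ
  have hC₀ : 0 ≤ ∑ χ : DirichletCharacter ℂ q, ‖χ a⁻¹‖ * C χ :=
    Finset.sum_nonneg fun χ _ ↦ mul_nonneg (norm_nonneg _) (hC χ).le
  have hC₁ := hC 1
  refine ⟨κ χ₀, ‖(q.totient : ℂ)⁻¹‖ * (1 + C 1 + ∑ χ : DirichletCharacter ℂ q, ‖χ a⁻¹‖ * C χ) + 1, hκ χ₀, hκ' χ₀, by positivity,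
    fun s hs hs₁ hs₃ ↦ ?_⟩
  set T := |s.im| ^ (1 / 20 : ℝ)
  have hT : 1 ≤ T := Real.one_le_rpow (by linarith) (by norm_num)
  have hT5 : 1 ≤ T ^ 5 := one_le_pow₀ hT
  have key (χ : DirichletCharacter ℂ q) := h χ s hs ((by gcongr; exact hχ₀ χ : _ ≤ _).trans hs₁) hs₃
  have hne : s ≠ 1 := by
    rintro rfl
    norm_num at hs
  have hnorm : 1 ≤ ‖s - 1‖ := by
    have := abs_im_le_norm (s - 1)
    simp at this
    linarith
  refine ⟨analyticAt_LFunctionResidueClassAux a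
    (LFunctionTrivChar₁_ne_zero_of hne (key 1).1) fun χ _ ↦ (key χ).1, ?_⟩
  have hT₁ : ‖-deriv (LFunctionTrivChar₁ q) s / LFunctionTrivChar₁ q s‖ ≤ (1 + C 1) * T ^ 5 := by
    have e : deriv (LFunctionTrivChar₁ q) s / LFunctionTrivChar₁ q s =
        deriv (LFunctionTrivChar q) s / LFunctionTrivChar q s + (s - 1)⁻¹ := by
      have h0 : LFunctionTrivChar q s ≠ 0 := (key 1).1
      have := sub_ne_zero_of_ne hne
      rw [deriv_LFunctionTrivChar₁_apply_of_ne_one _ hne, LFunctionTrivChar₁,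
        Function.update_of_ne hne]
      field_simp
    rw [neg_div, norm_neg, e]
    refine (norm_add_le _ _).trans ?_
    have h1 := (key 1).2
    have h2 : ‖(s - 1)⁻¹‖ ≤ 1 := by
      rw [norm_inv]
      exact inv_le_one_of_one_le₀ hnorm
    simp only [LFunctionTrivChar]
    linarith
  have hsum (S : Finset (DirichletCharacter ℂ q)) : ‖∑ χ ∈ S,
      χ a⁻¹ * deriv (LFunction χ) s / LFunction χ s‖ ≤
      (∑ χ : DirichletCharacter ℂ q, ‖χ a⁻¹‖ * C χ) * T ^ 5 := by
    rw [Finset.sum_mul]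
    refine (norm_sum_le _ _).trans ((Finset.sum_le_sum fun χ _ ↦ ?_).trans
      (Finset.sum_le_univ_sum_of_nonneg fun χ ↦ by have := hC χ; positivity))
    rw [mul_div_assoc, norm_mul, mul_assoc]
    gcongr
    exact (key χ).2
  rw [LFunctionResidueClassAux, norm_mul]
  calc _ ≤ ‖(q.totient : ℂ)⁻¹‖ * ((1 + C 1) * T ^ 5 +
        (∑ χ : DirichletCharacter ℂ q, ‖χ a⁻¹‖ * C χ) * T ^ 5) := by
        gcongr
        refine (norm_sub_le _ _).trans (add_le_add hT₁ ?_)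
        exact hsum _
    _ ≤ _ := by nlinarith

end ResidueClassAux

section SecondDerivative

open Complex Set DirichletCharacter

lemma exists_norm_deriv_deriv_le {H : ℂ → ℂ} {κ C : ℝ} (hκ : 0 < κ) (hκ' : κ ≤ 1 / 100)
    (hC : 0 < C) (hH : ∀ s : ℂ, 2 ≤ |s.im| →
      1 - κ / (|s.im| ^ (1 / 20 : ℝ)) ^ 5 ≤ s.re → s.re ≤ 3 →
      AnalyticAt ℂ H s ∧ ‖H s‖ ≤ C * (|s.im| ^ (1 / 20 : ℝ)) ^ 5) :
    ∃ C' : ℝ, 0 < C' ∧ ∀ s : ℂ, 4 ≤ |s.im| → 1 ≤ s.re → s.re ≤ 2 →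
      ‖deriv (deriv fun s ↦ H s / (s * (s + 1))) s‖ ≤ C' * |s.im| ^ (-(5 / 4) : ℝ) := by
  refine ⟨2 * (C * 32 * 4) / (κ / 32) ^ 2, by positivity, fun s hs hs₁ hs₂ ↦ ?_⟩
  set T := |s.im| ^ (1 / 20 : ℝ) with hTdef
  have hs0 : 0 < |s.im| := by linarith
  have hT : 1 ≤ T := Real.one_le_rpow (by linarith) (by norm_num)
  have hT5 : 1 ≤ T ^ 5 := one_le_pow₀ hT
  set r := κ / (32 * T ^ 5) with hr
  have hr0 : 0 < r := by positivity
  have hr1 : r ≤ 1 := by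
    rw [hr, div_le_one (by positivity)]
    linarith
  have key : ∀ z ∈ Metric.closedBall s r,
      AnalyticAt ℂ H z ∧ ‖H z‖ ≤ C * (32 * T ^ 5) ∧ |s.im| / 2 ≤ |z.im| := by
    intro z hz
    rw [mem_closedBall_iff_norm] at hz
    have him : |z.im - s.im| ≤ r := by simpa using (abs_im_le_norm (z - s)).trans hz
    have hre : |z.re - s.re| ≤ r := by simpa using (abs_re_le_norm (z - s)).trans hz
    have h1 : |s.im| / 2 ≤ |z.im| := by
      have := abs_sub_abs_le_abs_sub s.im z.im
      rw [abs_sub_comm] at this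
      linarith
    have h2 : |z.im| ≤ 2 * |s.im| := by
      have := abs_sub_abs_le_abs_sub z.im s.im
      linarith
    have hz0 : 0 < |z.im| := by linarith
    have hTz : (|z.im| ^ (1 / 20 : ℝ)) ^ 5 ≤ 32 * T ^ 5 := by
      calc _ ≤ (2 * T) ^ 5 := by gcongr; exact rpow_abs_le_two_mul h2
        _ = _ := by ring
    have h3 : r ≤ κ / (|z.im| ^ (1 / 20 : ℝ)) ^ 5 := by
      rw [hr]
      gcongr
    rw [abs_le] at hre
    obtain ⟨ha, hb⟩ := hH z (by linarith) (by linarith) (by linarith)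
    exact ⟨ha, hb.trans (by gcongr), h1⟩
  have hne : ∀ z ∈ Metric.closedBall s r, z ≠ 0 ∧ z + 1 ≠ 0 ∧
      (|s.im| / 2) ^ 2 ≤ ‖z * (z + 1)‖ := by
    intro z hz
    have h1 := (key z hz).2.2
    have h2 : |s.im| / 2 ≤ ‖z‖ := h1.trans (abs_im_le_norm z)
    have h3 : |s.im| / 2 ≤ ‖z + 1‖ := by
      have := abs_im_le_norm (z + 1)
      simp only [add_im, one_im, add_zero] at this
      exact h1.trans this
    refine ⟨norm_pos_iff.mp (by linarith), norm_pos_iff.mp (by linarith), ?_⟩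
    rw [norm_mul, sq]
    gcongr
  have hdiff : DifferentiableOn ℂ (fun s ↦ H s / (s * (s + 1))) (Metric.closedBall s r) := by
    intro z hz
    have hd : DifferentiableAt ℂ (fun s : ℂ ↦ s * (s + 1)) z := by fun_prop
    exact ((key z hz).1.differentiableAt.fun_div hd
      (mul_ne_zero (hne z hz).1 (hne z hz).2.1)).differentiableWithinAt
  have hcauchy := Complex.norm_iteratedDeriv_le_of_forall_mem_sphere_norm_le 2 hr0
    (hdiff.diffContOnCl_ball subset_rfl) (C := C * (32 * T ^ 5) / (|s.im| / 2) ^ 2) (by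
      intro z hz
      have hz := Metric.sphere_subset_closedBall hz
      rw [norm_div]
      have := (hne z hz).2.2
      have := (key z hz).2.1
      gcongr)
  simp only [iteratedDeriv_succ, iteratedDeriv_zero] at hcauchy
  refine hcauchy.trans (le_of_eq ?_)
  have e : |s.im| ^ (-(5 / 4) : ℝ) = T ^ 15 / |s.im| ^ 2 := by
    rw [hTdef, ← Real.rpow_natCast, ← Real.rpow_natCast, ← Real.rpow_mul hs0.le,
      ← Real.rpow_sub hs0]
    norm_num
  rw [e, hr]
  have : |s.im| ≠ 0 := hs0.ne'
  have : T ≠ 0 := by positivity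
  have : κ ≠ 0 := hκ.ne'
  simp only [Nat.factorial]
  push_cast
  field_simp
  norm_num

lemma exists_norm_deriv_deriv_LFunctionResidueClassAux_le {q : ℕ} [NeZero q] (a : ZMod q) :
    ∃ C : ℝ, 0 < C ∧ ∀ x t : ℝ, 0 ≤ x → x ≤ 1 →
      ‖deriv (deriv fun s ↦ ArithmeticFunction.vonMangoldt.LFunctionResidueClassAux a s /
        (s * (s + 1))) (1 + x + t * I)‖ ≤ C * (1 + |t|) ^ (-(5 / 4) : ℝ) := by
  obtain ⟨κ, C, hκ, hκ', hC, h⟩ := exists_norm_LFunctionResidueClassAux_le a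
  obtain ⟨C', hC', h'⟩ := exists_norm_deriv_deriv_le hκ hκ' hC h
  have hcont : ContinuousOn (deriv (deriv fun s ↦
      ArithmeticFunction.vonMangoldt.LFunctionResidueClassAux a s / (s * (s + 1))))
      (Icc 1 2 ×ℂ Icc (-4) 4) := by
    intro s hs
    have hs : 1 ≤ s.re := hs.1.1
    have h0 : s ≠ 0 := by rintro rfl; norm_num at hs
    have h1 : s + 1 ≠ 0 := fun h ↦ by
      have := congrArg re h
      simp at this
      linarith
    have hd : AnalyticAt ℂ (fun s : ℂ ↦ s * (s + 1)) s := by fun_prop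
    exact ((analyticAt_LFunctionResidueClassAux_of_one_le_re a hs).fun_div hd
      (mul_ne_zero h0 h1)).deriv.deriv.continuousAt.continuousWithinAt
  obtain ⟨M, hM⟩ := (isCompact_Icc.reProdIm isCompact_Icc).exists_bound_of_continuousOn hcont
  have hM0 : 0 ≤ M := (norm_nonneg _).trans (hM 1 (by simp [mem_reProdIm]))
  refine ⟨(C' * 2 ^ (5 / 4 : ℝ)) + M * 5 ^ (5 / 4 : ℝ), by positivity, fun x t hx hx1 ↦ ?_⟩
  have hre : (1 + x + t * I : ℂ).re = 1 + x := by simp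
  have him : (1 + x + t * I : ℂ).im = t := by simp
  have hpos : 0 < 1 + |t| := by positivity
  have hp := Real.rpow_pos_of_pos hpos (-(5 / 4) : ℝ)
  have h25 : (0 : ℝ) < 2 ^ (5 / 4 : ℝ) := by positivity
  have h55 : (0 : ℝ) < 5 ^ (5 / 4 : ℝ) := by positivity
  rcases le_total 4 |t| with ht | ht
  · have h1 := h' (1 + x + t * I) (by rwa [him]) (by linarith) (by linarith)
    rw [him] at h1
    refine h1.trans ?_
    have h2 : |t| ^ (-(5 / 4) : ℝ) ≤ 2 ^ (5 / 4 : ℝ) * (1 + |t|) ^ (-(5 / 4) : ℝ) := by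
      calc |t| ^ (-(5 / 4) : ℝ) ≤ ((1 + |t|) / 2) ^ (-(5 / 4) : ℝ) :=
            Real.rpow_le_rpow_of_nonpos (by positivity) (by linarith) (by norm_num)
        _ = _ := by
          rw [Real.div_rpow hpos.le (by norm_num), Real.rpow_neg zero_le_two, div_inv_eq_mul,
            mul_comm]
    calc _ ≤ C' * (2 ^ (5 / 4 : ℝ) * (1 + |t|) ^ (-(5 / 4) : ℝ)) := by gcongr
      _ ≤ _ := by nlinarith [mul_nonneg (mul_nonneg hM0 h55.le) hp.le]
  · have h1 := hM (1 + x + t * I) (by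
      rw [mem_reProdIm, hre, him]
      exact ⟨⟨by linarith, by linarith⟩, abs_le.mp ht⟩)
    refine h1.trans ?_
    have h2 : 1 ≤ 5 ^ (5 / 4 : ℝ) * (1 + |t|) ^ (-(5 / 4) : ℝ) := by
      rw [Real.rpow_neg hpos.le, ← div_eq_mul_inv, ← Real.div_rpow (by norm_num) hpos.le]
      refine Real.one_le_rpow ?_ (by norm_num)
      rw [le_div_iff₀ hpos]
      linarith
    nlinarith [mul_nonneg (mul_nonneg hC'.le h25.le) hp.le]

end SecondDerivative

section RieszMean

open Complex Set

open MeasureTheory Filter Topology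

lemma ContinuousOn.mellinConvergent_of_eq_zero {f : ℝ → ℂ} {b : ℝ} {s : ℂ}
    (hf : ContinuousOn f (Ioi 0)) (h₁ : ∀ v, 1 < v → f v = 0)
    (h₀ : f =O[𝓝[>] 0] fun v ↦ v ^ (-b)) (hs : b < s.re) : MellinConvergent f s := by
  refine mellinConvergent_of_isBigO_rpow (a := s.re + 1)
    (hf.locallyIntegrableOn measurableSet_Ioi) ?_ (by linarith) h₀ hs
  exact (Asymptotics.isBigO_zero _ _).congr'
    ((eventually_gt_atTop 1).mono fun v hv ↦ (h₁ v hv).symm) EventuallyEq.rfl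

lemma hasMellin_max_one_sub {s : ℂ} (hs : 0 < s.re) :
    HasMellin (fun v : ℝ ↦ ((max (1 - v) 0 : ℝ) : ℂ)) s (1 / (s * (s + 1))) := by
  have h0 := hasMellin_cpow_Ioc 0 (s := s) (by simpa)
  have h1 := hasMellin_cpow_Ioc 1 (s := s) (by simp; linarith)
  have h := hasMellin_sub h0.1 h1.1
  rw [h0.2, h1.2] at h
  have hs0 : s ≠ 0 := by rintro rfl; simp at hs
  have hs1 : s + 1 ≠ 0 := fun h ↦ by
    have := congrArg re h
    simp at this
    linarith
  have e : EqOn (fun t : ℝ ↦ (Ioc 0 1).indicator (fun t : ℝ ↦ (t : ℂ) ^ (0 : ℂ)) t -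
      (Ioc 0 1).indicator (fun t : ℝ ↦ (t : ℂ) ^ (1 : ℂ)) t)
      (fun v : ℝ ↦ ((max (1 - v) 0 : ℝ) : ℂ)) (Ioi 0) := by
    intro v hv
    by_cases hv1 : v ≤ 1
    · have : v ∈ Ioc (0 : ℝ) 1 := ⟨hv, hv1⟩
      simp [this, hv1]
    · have : v ∉ Ioc (0 : ℝ) 1 := fun h ↦ hv1 h.2
      simp [this, (not_le.mp hv1).le]
  refine ⟨h.1.congr_fun (fun v hv ↦ ?_) measurableSet_Ioi, ?_⟩
  · simp only [e hv]
  · have e2 : 1 / (s + 0) - 1 / (s + 1) = 1 / (s * (s + 1)) := by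
      rw [add_zero]
      field_simp
      ring
    rw [← e2, ← h.2]
    refine setIntegral_congr_fun measurableSet_Ioi fun v hv ↦ ?_
    simp only [e hv]

lemma hasMellin_max_one_sub_sq_div {s : ℂ} (hs : 1 < s.re) :
    HasMellin (fun v : ℝ ↦ ((max (1 - v) 0 ^ 2 / (2 * v) : ℝ) : ℂ)) s
      (1 / ((s - 1) * (s * (s + 1)))) := by
  have h0 := hasMellin_cpow_Ioc (-1) (s := s) (by simp; linarith)
  have h1 := hasMellin_max_one_sub (s := s) (by linarith)
  have h2 := hasMellin_cpow_Ioc 0 (s := s) (by simp; linarith)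
  have h3 := hasMellin_sub h0.1 h2.1
  have h := hasMellin_sub (h3.1.const_smul (1 / 2 : ℂ)) (h1.1.const_smul (1 / 2 : ℂ))
  rw [mellin_const_smul, mellin_const_smul, h3.2, h1.2, h0.2, h2.2] at h
  have hs0 : s ≠ 0 := by rintro rfl; norm_num at hs
  have hs1 : s + 1 ≠ 0 := fun h ↦ by
    have := congrArg re h
    simp at this
    linarith
  have hs2 : s - 1 ≠ 0 := fun h ↦ by
    have := congrArg re h
    simp at this
    linarith
  have e : EqOn (fun t : ℝ ↦ (1 / 2 : ℂ) • ((Ioc 0 1).indicator (fun t : ℝ ↦ (t : ℂ) ^ (-1 : ℂ)) t -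
      (Ioc 0 1).indicator (fun t : ℝ ↦ (t : ℂ) ^ (0 : ℂ)) t) -
      (1 / 2 : ℂ) • ((max (1 - t) 0 : ℝ) : ℂ))
      (fun v : ℝ ↦ ((max (1 - v) 0 ^ 2 / (2 * v) : ℝ) : ℂ)) (Ioi 0) := by
    intro v hv
    have hv0 : (v : ℂ) ≠ 0 := ofReal_ne_zero.mpr (ne_of_gt hv)
    by_cases hv1 : v ≤ 1
    · have : v ∈ Ioc (0 : ℝ) 1 := ⟨hv, hv1⟩
      simp only [this, indicator_of_mem, cpow_neg_one, cpow_zero, smul_eq_mul,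
        max_eq_left (sub_nonneg.mpr hv1)]
      push_cast
      field_simp
    · have : v ∉ Ioc (0 : ℝ) 1 := fun h ↦ hv1 h.2
      simp [this, (not_le.mp hv1).le]
  refine ⟨h.1.congr_fun (fun v hv ↦ ?_) measurableSet_Ioi, ?_⟩
  · simp only [← e hv]
  · have e2 : (1 / 2 : ℂ) • (1 / (s + -1) - 1 / (s + 0)) - (1 / 2 : ℂ) • (1 / (s * (s + 1))) =
        1 / ((s - 1) * (s * (s + 1))) := by
      rw [add_zero, ← sub_eq_add_neg, smul_eq_mul, smul_eq_mul]
      field_simp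
      ring
    rw [← e2, ← h.2]
    refine setIntegral_congr_fun measurableSet_Ioi fun v hv ↦ ?_
    simp only [← e hv]

lemma integral_norm_cpow_smul_max_one_sub {s : ℂ} {n : ℝ} (hn : 0 < n) :
    ∫ t in Ioi (0 : ℝ), ‖(t : ℂ) ^ (s - 1) • ((max (1 - n * t) 0 : ℝ) : ℂ)‖ =
      n ^ (-s.re) * ∫ t in Ioi (0 : ℝ), ‖(t : ℂ) ^ (s - 1) • ((max (1 - t) 0 : ℝ) : ℂ)‖ := by
  have h := integral_comp_mul_left_Ioi
    (fun t : ℝ ↦ ‖(t : ℂ) ^ (s - 1) • ((max (1 - t) 0 : ℝ) : ℂ)‖) 0 hn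
  rw [mul_zero, smul_eq_mul, eq_inv_mul_iff_mul_eq₀ hn.ne'] at h
  rw [← h, ← integral_const_mul, ← integral_const_mul]
  refine setIntegral_congr_fun measurableSet_Ioi fun t ht ↦ ?_
  have ht : 0 < t := ht
  simp only [norm_smul, norm_cpow_eq_rpow_re_of_pos ht,
    norm_cpow_eq_rpow_re_of_pos (mul_pos hn ht)]
  rw [sub_re, one_re, Real.mul_rpow hn.le ht.le, Real.rpow_sub_one hn.ne', Real.rpow_neg hn.le]
  have := (Real.rpow_pos_of_pos hn s.re).ne'
  field_simp

lemma mellin_tsum_max_one_sub {b : ℕ → ℝ} (hb0 : b 0 = 0) {s : ℂ} (hs : 0 < s.re)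
    (hsum : LSeriesSummable (fun n ↦ (b n : ℂ)) s) :
    mellin (fun v : ℝ ↦ ((∑' n, b n * max (1 - n * v) 0 : ℝ) : ℂ)) s =
      LSeries (fun n ↦ (b n : ℂ)) s / (s * (s + 1)) := by
  have hk := hasMellin_max_one_sub hs
  set F : ℕ → ℝ → ℂ := fun n t ↦ (t : ℂ) ^ (s - 1) • ((b n : ℂ) • ((max (1 - n * t) 0 : ℝ) : ℂ))
    with hF
  have hF0 : F 0 = 0 := by
    ext t
    simp [hF, hb0]
  have hint (n : ℕ) : Integrable (F n) (volume.restrict (Ioi 0)) := by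
    rcases Nat.eq_zero_or_pos n with rfl | hn
    · rw [hF0]
      exact integrable_zero _ _ _
    · exact ((MellinConvergent.comp_mul_left (f := fun v : ℝ ↦ ((max (1 - v) 0 : ℝ) : ℂ))
        (Nat.cast_pos.mpr hn)).mpr hk.1).const_smul (b n : ℂ)
  have hval (n : ℕ) : ∫ t in Ioi (0 : ℝ), F n t =
      LSeries.term (fun n ↦ (b n : ℂ)) s n * (1 / (s * (s + 1))) := by
    rcases Nat.eq_zero_or_pos n with rfl | hn
    · simp [hF0]
    · have h1 := mellin_const_smul (fun t : ℝ ↦ ((max (1 - n * t) 0 : ℝ) : ℂ)) s (b n : ℂ)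
      have h2 := mellin_comp_mul_left (fun v : ℝ ↦ ((max (1 - v) 0 : ℝ) : ℂ)) s
        (a := n) (Nat.cast_pos.mpr hn)
      rw [h2, hk.2] at h1
      refine h1.trans ?_
      rw [LSeries.term_of_ne_zero hn.ne', smul_eq_mul, smul_eq_mul, cpow_neg, ofReal_natCast,
        div_eq_mul_inv (b n : ℂ), mul_assoc]
  have hnorm (n : ℕ) : ∫ t in Ioi (0 : ℝ), ‖F n t‖ = ‖LSeries.term (fun n ↦ (b n : ℂ)) s n‖ *
      ∫ t in Ioi (0 : ℝ), ‖(t : ℂ) ^ (s - 1) • ((max (1 - t) 0 : ℝ) : ℂ)‖ := by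
    rcases Nat.eq_zero_or_pos n with rfl | hn
    · simp [hF0]
    · have hn' : (0 : ℝ) < n := Nat.cast_pos.mpr hn
      rw [LSeries.term_of_ne_zero hn.ne', norm_div, norm_natCast_cpow_of_pos hn, div_eq_mul_inv,
        ← Real.rpow_neg hn'.le, mul_assoc, ← integral_norm_cpow_smul_max_one_sub hn',
        ← integral_const_mul]
      congr 1 with t
      simp only [hF]
      rw [smul_comm, norm_smul]
  have hs' := hasSum_integral_of_summable_integral_norm hint (by
    simp_rw [hnorm]
    exact hsum.norm.mul_right _)
  have := hs'.unique (by simp_rw [hval]; exact hsum.hasSum.mul_right _)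
  rw [LSeries, div_eq_mul_one_div, ← this, mellin]
  congr 1 with t
  rw [tsum_const_smul'', ofReal_tsum]
  simp
end RieszMean

section RieszBound

open Complex Set

open MeasureTheory Filter Topology

lemma tsum_mul_max_one_sub_eq_sum (b : ℕ → ℝ) {v : ℝ} {N : ℕ} (hv : 0 < v) (hN : 1 ≤ N * v) :
    ∑' n, b n * max (1 - n * v) 0 = ∑ n ∈ Finset.range N, b n * max (1 - n * v) 0 := by
  refine tsum_eq_sum fun n hn ↦ ?_
  have hn : N ≤ n := by simpa using hn
  rw [max_eq_right, mul_zero]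
  have : (N : ℝ) * v ≤ n * v := by gcongr
  linarith

lemma continuousOn_tsum_mul_max_one_sub (b : ℕ → ℝ) :
    ContinuousOn (fun v : ℝ ↦ ∑' n, b n * max (1 - n * v) 0) (Ioi 0) := by
  intro v hv
  have hv : 0 < v := hv
  obtain ⟨N, hN⟩ := exists_nat_gt (1 / v)
  rw [div_lt_iff₀ hv] at hN
  have h1 : ContinuousAt (fun v : ℝ ↦ ∑ n ∈ Finset.range N, b n * max (1 - n * v) 0) v := by
    fun_prop
  refine (h1.congr ?_).continuousWithinAt
  have h2 : ∀ᶠ w : ℝ in 𝓝 v, 1 < N * w :=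
    (continuousAt_const.mul continuousAt_id).eventually_const_lt hN
  filter_upwards [h2, lt_mem_nhds hv] with w hw hw0
  exact (tsum_mul_max_one_sub_eq_sum b hw0 hw.le).symm

lemma tsum_mul_max_one_sub_le {b : ℕ → ℝ} (hb : ∀ n, 0 ≤ b n) {M : ℝ}
    (hM : ∀ N : ℕ, ∑ n ∈ Finset.range (N + 1), b n ≤ M * N) {v : ℝ} (hv : 0 < v) :
    0 ≤ ∑' n, b n * max (1 - n * v) 0 ∧ ∑' n, b n * max (1 - n * v) 0 ≤ M / v := by
  have hM0 : 0 ≤ M := by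
    have := (Finset.sum_nonneg fun n _ ↦ hb n).trans (hM 1)
    simpa using this
  refine ⟨tsum_nonneg fun n ↦ mul_nonneg (hb n) (le_max_right _ _), ?_⟩
  have hN : 1 ≤ ((⌊1 / v⌋₊ + 1 : ℕ) : ℝ) * v := by
    rw [← div_le_iff₀ hv]
    push_cast
    exact (Nat.lt_floor_add_one _).le
  rw [tsum_mul_max_one_sub_eq_sum b hv hN]
  calc _ ≤ ∑ n ∈ Finset.range (⌊1 / v⌋₊ + 1), b n := by
        refine Finset.sum_le_sum fun n _ ↦ mul_le_of_le_one_right (hb n) (max_le ?_ zero_le_one)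
        have : 0 ≤ n * v := by positivity
        linarith
    _ ≤ M * ⌊1 / v⌋₊ := hM _
    _ ≤ M * (1 / v) := by
        gcongr
        exact Nat.floor_le (by positivity)
    _ = M / v := by ring

/-- The error term of the Riesz mean of `b` in terms of `v = 1 / u`, with expected main term
`c * u / 2`. -/
noncomputable def rieszError (b : ℕ → ℝ) (c v : ℝ) : ℝ :=
  ∑' n, b n * max (1 - n * v) 0 - c * (max (1 - v) 0 ^ 2 / (2 * v))

variable {b : ℕ → ℝ} {c M : ℝ}

lemma continuousOn_rieszError (b : ℕ → ℝ) (c : ℝ) : ContinuousOn (rieszError b c) (Ioi 0) := by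
  refine (continuousOn_tsum_mul_max_one_sub b).sub (continuousOn_const.mul ?_)
  refine ContinuousOn.div (by fun_prop) (by fun_prop) fun v hv ↦ ?_
  have : 0 < v := hv
  positivity

lemma rieszError_of_one_le (hb0 : b 0 = 0) {v : ℝ} (hv : 1 ≤ v) : rieszError b c v = 0 := by
  rw [rieszError, tsum_mul_max_one_sub_eq_sum b (N := 1) (by linarith) (by simpa using hv),
    max_eq_right (b := (0 : ℝ)) (a := 1 - v) (by linarith)]
  simp [hb0]

lemma abs_rieszError_le (hb : ∀ n, 0 ≤ b n) (hc : 0 ≤ c)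
    (hM : ∀ N : ℕ, ∑ n ∈ Finset.range (N + 1), b n ≤ M * N) {v : ℝ} (hv : 0 < v) :
    |rieszError b c v| ≤ (M + c) * v ^ (-1 : ℝ) := by
  obtain ⟨h1, h2⟩ := tsum_mul_max_one_sub_le hb hM hv
  have h3 : 0 ≤ c * (max (1 - v) 0 ^ 2 / (2 * v)) := by positivity
  have h4 : c * (max (1 - v) 0 ^ 2 / (2 * v)) ≤ c * (1 ^ 2 / (1 * v)) := by
    gcongr
    · exact max_le (by linarith) zero_le_one
    · norm_num
  rw [Real.rpow_neg_one, rieszError, abs_le]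
  have : (M + c) * v⁻¹ = M / v + c * (1 ^ 2 / (1 * v)) := by ring
  have h5 := h1.trans h2
  have h6 : 0 ≤ c * (1 ^ 2 / (1 * v)) := h3.trans h4
  constructor <;> linarith

lemma isBigO_rieszError (hb : ∀ n, 0 ≤ b n) (hc : 0 ≤ c)
    (hM : ∀ N : ℕ, ∑ n ∈ Finset.range (N + 1), b n ≤ M * N) :
    (fun v ↦ (rieszError b c v : ℂ)) =O[𝓝[>] 0] fun v : ℝ ↦ v ^ (-1 : ℝ) := by
  refine Asymptotics.IsBigO.of_bound (M + c) ?_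
  filter_upwards [self_mem_nhdsWithin] with v hv
  have hv : 0 < v := hv
  rw [norm_real, Real.norm_eq_abs, Real.norm_of_nonneg (by positivity)]
  exact abs_rieszError_le hb hc hM hv

lemma mellin_rieszError (hb : ∀ n, 0 ≤ b n) (hb0 : b 0 = 0)
    (hM : ∀ N : ℕ, ∑ n ∈ Finset.range (N + 1), b n ≤ M * N) {s : ℂ} (hs : 1 < s.re)
    (hsum : LSeriesSummable (fun n ↦ (b n : ℂ)) s) :
    mellin (fun v ↦ (rieszError b c v : ℂ)) s =
      (LSeries (fun n ↦ (b n : ℂ)) s - c / (s - 1)) / (s * (s + 1)) := by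
  have h1 := mellin_tsum_max_one_sub hb0 (by linarith) hsum
  have h2 := hasMellin_max_one_sub_sq_div hs
  have h3 : MellinConvergent (fun v : ℝ ↦ ((∑' n, b n * max (1 - n * v) 0 : ℝ) : ℂ)) s := by
    refine ContinuousOn.mellinConvergent_of_eq_zero (b := 1)
      (continuous_ofReal.comp_continuousOn (continuousOn_tsum_mul_max_one_sub b))
      (fun v hv ↦ ?_) ?_ hs
    · have := rieszError_of_one_le (c := 0) hb0 hv.le
      rw [rieszError, zero_mul, sub_zero] at this
      rw [this, ofReal_zero]
    · simpa [rieszError] using isBigO_rieszError hb le_rfl hM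
  have h := (hasMellin_sub h3 (h2.1.const_smul (c : ℂ))).2
  rw [mellin_const_smul, h1, h2.2] at h
  have e : (LSeries (fun n ↦ (b n : ℂ)) s - c / (s - 1)) / (s * (s + 1)) =
      LSeries (fun n ↦ (b n : ℂ)) s / (s * (s + 1)) - (c : ℂ) • (1 / ((s - 1) * (s * (s + 1)))) := by
    rw [smul_eq_mul, sub_div, div_div, mul_one_div]
  rw [e, ← h]
  simp [rieszError]

end RieszBound

section RieszInversion

open Complex Set

open MeasureTheory Filter Topology

lemma integrable_one_add_abs_rpow : Integrable fun t : ℝ ↦ (1 + |t|) ^ (-(5 / 4) : ℝ) := by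
  have := integrable_one_add_norm (E := ℝ) (μ := volume) (r := 5 / 4) (by norm_num)
  simpa using this

lemma isBigO_log_smul {f : ℝ → ℂ} {b b' : ℝ} (hf : f =O[𝓝[>] 0] fun v ↦ v ^ (-b)) (h : b < b') :
    (fun v ↦ Real.log v • f v) =O[𝓝[>] 0] fun v ↦ v ^ (-b') := by
  have h1 := (isLittleO_log_rpow_nhdsGT_zero (r := b - b') (by linarith)).isBigO.smul hf
  refine h1.congr' EventuallyEq.rfl ?_
  filter_upwards [self_mem_nhdsWithin] with v hv
  rw [smul_eq_mul, ← Real.rpow_add hv]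
  ring_nf

lemma ContinuousOn.hasDerivAt_mellin_of_eq_zero {f : ℝ → ℂ} {b : ℝ} {s : ℂ}
    (hf : ContinuousOn f (Ioi 0)) (h₁ : ∀ v, 1 < v → f v = 0)
    (h₀ : f =O[𝓝[>] 0] fun v ↦ v ^ (-b)) (hs : b < s.re) :
    HasDerivAt (mellin f) (mellin (fun v ↦ Real.log v • f v) s) s := by
  refine (mellin_hasDerivAt_of_isBigO_rpow (a := s.re + 1)
    (hf.locallyIntegrableOn measurableSet_Ioi) ?_ (by linarith) h₀ hs).2
  exact (Asymptotics.isBigO_zero _ _).congr'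
    ((eventually_gt_atTop 1).mono fun v hv ↦ (h₁ v hv).symm) EventuallyEq.rfl

lemma continuousOn_log_smul {f : ℝ → ℂ} (hf : ContinuousOn f (Ioi 0)) :
    ContinuousOn (fun v ↦ Real.log v • f v) (Ioi 0) :=
  (Real.continuousOn_log.mono fun _ hv ↦ ne_of_gt hv).smul hf

/-- If the second derivative of the Mellin transform `K` of `f` is integrable on vertical lines,
uniformly near `re s = 1`, then `f` gains a factor `log ^ 2` over the trivial bound. -/
lemma exists_log_sq_mul_norm_le {f : ℝ → ℂ} {K : ℂ → ℂ} {C : ℝ}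
    (hf : ContinuousOn f (Ioi 0)) (h₁ : ∀ v, 1 < v → f v = 0)
    (h₀ : f =O[𝓝[>] 0] fun v ↦ v ^ (-1 : ℝ)) (hK : ∀ s : ℂ, 1 < s.re → mellin f s = K s)
    (hK₂ : ∀ x t : ℝ, 0 ≤ x → x ≤ 1 →
      ‖deriv (deriv K) (1 + x + t * I)‖ ≤ C * (1 + |t|) ^ (-(5 / 4) : ℝ)) :
    ∃ C' : ℝ, ∀ v : ℝ, 0 < v → Real.log v ^ 2 * ‖f v‖ ≤ C' / v := by
  set U : Set ℂ := {s | 1 < s.re} with hU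
  have hUo : IsOpen U := isOpen_lt continuous_const continuous_re
  set f₁ : ℝ → ℂ := fun v ↦ Real.log v • f v with hf₁
  set f₂ : ℝ → ℂ := fun v ↦ Real.log v • f₁ v with hf₂
  have hc₁ : ContinuousOn f₁ (Ioi 0) := continuousOn_log_smul hf
  have hc₂ : ContinuousOn f₂ (Ioi 0) := continuousOn_log_smul hc₁
  have hz₁ : ∀ v, 1 < v → f₁ v = 0 := fun v hv ↦ by simp [hf₁, h₁ v hv]
  have hz₂ : ∀ v, 1 < v → f₂ v = 0 := fun v hv ↦ by simp [hf₂, hz₁ v hv]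
  have hO₁ {b : ℝ} (hb : 1 < b) : f₁ =O[𝓝[>] 0] fun v ↦ v ^ (-b) := isBigO_log_smul h₀ hb
  have hO₂ {b : ℝ} (hb : 1 < b) : f₂ =O[𝓝[>] 0] fun v ↦ v ^ (-b) :=
    isBigO_log_smul (hO₁ (b := (1 + b) / 2) (by linarith)) (by linarith)
  have hd (s : ℂ) (hs : s ∈ U) : HasDerivAt (mellin f) (mellin f₁ s) s :=
    hf.hasDerivAt_mellin_of_eq_zero h₁ h₀ hs
  have hd₁ (s : ℂ) (hs : s ∈ U) : HasDerivAt (mellin f₁) (mellin f₂ s) s := by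
    have hs : 1 < s.re := hs
    exact hc₁.hasDerivAt_mellin_of_eq_zero hz₁ (hO₁ (b := (1 + s.re) / 2) (by linarith))
      (by linarith)
  have hd₂ (s : ℂ) (hs : s ∈ U) : ContinuousAt (mellin f₂) s := by
    have hs : 1 < s.re := hs
    exact (hc₂.hasDerivAt_mellin_of_eq_zero hz₂ (hO₂ (b := (1 + s.re) / 2) (by linarith))
      (by linarith)).continuousAt
  have e₁ : EqOn (deriv K) (mellin f₁) U := fun s hs ↦ by
    rw [← (show EqOn (mellin f) K U from hK).deriv hUo hs, (hd s hs).deriv]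
  have e₂ : EqOn (deriv (deriv K)) (mellin f₂) U := fun s hs ↦ by
    rw [e₁.deriv hUo hs, (hd₁ s hs).deriv]
  have hint := integrable_one_add_abs_rpow.const_mul C
  set A := ∫ t : ℝ, C * (1 + |t|) ^ (-(5 / 4) : ℝ)
  have hbound (x t : ℝ) (hx : 0 < x) (hx1 : x ≤ 1) :
      ‖mellin f₂ ((1 + x : ℝ) + t * I)‖ ≤ C * (1 + |t|) ^ (-(5 / 4) : ℝ) := by
    have := hK₂ x t hx.le hx1
    rw [e₂ (by simp [hU, hx])] at this
    simpa using this
  have key (v x : ℝ) (hv : 0 < v) (hx : 0 < x) (hx1 : x ≤ 1) :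
      Real.log v ^ 2 * ‖f v‖ ≤ 1 / (2 * Real.pi) * (v ^ (-(1 + x)) * A) := by
    have hre : 1 < (((1 + x : ℝ) : ℂ)).re := by simpa using hx
    have hmc : MellinConvergent f₂ ((1 + x : ℝ) : ℂ) :=
      hc₂.mellinConvergent_of_eq_zero hz₂ (hO₂ (b := 1 + x / 2) (by linarith))
        (by simp only [ofReal_re]; linarith)
    have hcont : Continuous fun t : ℝ ↦ mellin f₂ ((1 + x : ℝ) + t * I) := by
      refine continuous_iff_continuousAt.mpr fun t ↦ ?_
      exact ContinuousAt.comp (f := fun t : ℝ ↦ ((1 + x : ℝ) : ℂ) + t * I)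
        (hd₂ _ (by simp [hU, hx])) (by fun_prop)
    have hvi : VerticalIntegrable (mellin f₂) (1 + x) :=
      hint.mono' hcont.aestronglyMeasurable (.of_forall fun t ↦ hbound x t hx hx1)
    have hinv := mellinInv_mellin_eq (1 + x) f₂ hv hmc hvi (hc₂.continuousAt (Ioi_mem_nhds hv))
    have hf₂v : ‖f₂ v‖ = Real.log v ^ 2 * ‖f v‖ := by
      simp only [hf₂, hf₁, norm_smul, Real.norm_eq_abs]
      rw [← mul_assoc, ← sq, sq_abs]
    rw [← hf₂v, ← hinv, mellinInv, norm_smul, Real.norm_of_nonneg (by positivity)]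
    gcongr
    rw [← integral_const_mul]
    refine norm_integral_le_of_norm_le (hint.const_mul _) (.of_forall fun t ↦ ?_)
    rw [norm_smul, norm_cpow_eq_rpow_re_of_pos hv]
    have : (-(((1 + x : ℝ) : ℂ) + t * I)).re = -(1 + x) := by simp
    rw [this]
    gcongr
    exact hbound x t hx hx1
  refine ⟨1 / (2 * Real.pi) * A, fun v hv ↦ ?_⟩
  have hlim : Tendsto (fun x : ℝ ↦ 1 / (2 * Real.pi) * (v ^ (-(1 + x)) * A)) (𝓝[>] 0)
      (𝓝 (1 / (2 * Real.pi) * (v ^ (-(1 + 0) : ℝ) * A))) := by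
    refine (Continuous.tendsto ?_ 0).mono_left nhdsWithin_le_nhds
    have : Continuous fun x : ℝ ↦ v ^ (-(1 + x)) :=
      Continuous.rpow continuous_const (by fun_prop) fun _ ↦ .inl hv.ne'
    fun_prop
  have h := ge_of_tendsto hlim (b := Real.log v ^ 2 * ‖f v‖) (by
    filter_upwards [Ioc_mem_nhdsGT one_pos] with x hx
    exact key v x hv hx.1 hx.2)
  refine h.trans (le_of_eq ?_)
  rw [add_zero, Real.rpow_neg_one]
  ring

end RieszInversion

section Differencing

open Set

variable {b : ℕ → ℝ} {c C : ℝ}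

lemma abs_sum_max_sub_le
    (h : ∀ v : ℝ, 0 < v → Real.log v ^ 2 * |rieszError b c v| ≤ C / v) {u : ℝ} (hu : 1 < u)
    {N : ℕ} (hN : u ≤ N) :
    |∑ n ∈ Finset.range N, b n * max (u - n) 0 - c * ((u - 1) ^ 2 / 2)| ≤
      C * (u ^ 2 / Real.log u ^ 2) := by
  have hu0 : 0 < u := by linarith
  have hlog : 0 < Real.log u := Real.log_pos hu
  have h1 := h u⁻¹ (inv_pos.mpr hu0)
  rw [Real.log_inv, neg_sq, div_inv_eq_mul] at h1
  have e : u * rieszError b c u⁻¹ =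
      ∑ n ∈ Finset.range N, b n * max (u - n) 0 - c * ((u - 1) ^ 2 / 2) := by
    have hv : u⁻¹ ≤ 1 := inv_le_one_of_one_le₀ hu.le
    rw [rieszError, tsum_mul_max_one_sub_eq_sum b (inv_pos.mpr hu0) (N := N)
      (by rwa [← div_eq_mul_inv, one_le_div hu0]), mul_sub, Finset.mul_sum,
      max_eq_left (b := (0 : ℝ)) (a := 1 - u⁻¹) (by linarith)]
    congr 1
    · refine Finset.sum_congr rfl fun n _ ↦ ?_
      rw [mul_left_comm, mul_max_of_nonneg _ _ hu0.le, mul_zero]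
      congr 2
      field_simp
    · field_simp
  rw [← e, abs_mul, abs_of_pos hu0, ← mul_div_assoc, le_div_iff₀ (by positivity)]
  calc _ = u * (Real.log u ^ 2 * |rieszError b c u⁻¹|) := by ring
    _ ≤ u * (C * u) := by gcongr
    _ = _ := by ring

lemma mul_sum_le_sum_max_sub_sum_max (hb : ∀ n, 0 ≤ b n) {N M : ℕ} (hNM : N + 1 ≤ M) {h : ℝ}
    (hh : 0 ≤ h) :
    h * ∑ n ∈ Finset.range (N + 1), b n ≤
      ∑ n ∈ Finset.range M, b n * max (N + h - n) 0 -
        ∑ n ∈ Finset.range M, b n * max ((N : ℝ) - n) 0 := by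
  rw [← Finset.sum_sub_distrib, Finset.mul_sum]
  have hsub : Finset.range (N + 1) ⊆ Finset.range M := Finset.range_subset_range.mpr hNM
  refine le_trans ?_ (Finset.sum_le_sum_of_subset_of_nonneg hsub fun n _ _ ↦ ?_)
  · refine Finset.sum_le_sum fun n hn ↦ ?_
    have hn : (n : ℝ) ≤ N := by exact_mod_cast Finset.mem_range_succ_iff.mp hn
    rw [max_eq_left (by linarith), max_eq_left (by linarith)]
    linarith
  · rw [← mul_sub]
    refine mul_nonneg (hb n) (sub_nonneg.mpr (max_le_max ?_ le_rfl))
    linarith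

lemma sum_max_sub_sum_max_le_mul_sum (hb : ∀ n, 0 ≤ b n) {N M : ℕ} {h : ℝ} (hh : 0 ≤ h) :
    ∑ n ∈ Finset.range M, b n * max ((N : ℝ) - n) 0 -
        ∑ n ∈ Finset.range M, b n * max (N - h - n) 0 ≤
      h * ∑ n ∈ Finset.range (N + 1), b n := by
  rw [← Finset.sum_sub_distrib, Finset.mul_sum]
  calc _ ≤ ∑ n ∈ Finset.range M, if n ≤ N then h * b n else 0 := by
        refine Finset.sum_le_sum fun n _ ↦ ?_
        rw [← mul_sub]
        split_ifs with hn
        · have hn : (n : ℝ) ≤ N := by exact_mod_cast hn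
          rw [mul_comm h]
          refine mul_le_mul_of_nonneg_left ?_ (hb n)
          rw [max_eq_left (by linarith)]
          have := le_max_left (N - h - n) 0
          linarith
        · have hn : (N : ℝ) ≤ n := by exact_mod_cast (not_le.mp hn).le
          rw [max_eq_right (by linarith), max_eq_right (by linarith)]
          simp
    _ = ∑ n ∈ (Finset.range M).filter (· ≤ N), h * b n := (Finset.sum_filter _ _).symm
    _ ≤ _ := by
        refine Finset.sum_le_sum_of_subset_of_nonneg (fun n hn ↦ ?_)
          fun n _ _ ↦ mul_nonneg hh (hb n)
        simp only [Finset.mem_filter] at hn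
        exact Finset.mem_range_succ_iff.mpr hn.2

lemma abs_sum_sub_le (hb : ∀ n, 0 ≤ b n) (hc : 0 ≤ c) (hC : 0 ≤ C)
    (hR : ∀ u : ℝ, 1 < u → ∀ N : ℕ, u ≤ N →
      |∑ n ∈ Finset.range N, b n * max (u - n) 0 - c * ((u - 1) ^ 2 / 2)| ≤
        C * (u ^ 2 / Real.log u ^ 2)) {N : ℕ} (hN : 8 ≤ N) :
    |∑ n ∈ Finset.range (N + 1), b n - c * N| ≤ (2 * c + 5 * C) * (N / Real.log N) := by
  have hx : (8 : ℝ) ≤ N := by exact_mod_cast hN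
  set x : ℝ := (N : ℝ)
  set L := Real.log x with hL
  have hlog2 := Real.log_two_gt_d9
  have hL8 : 3 * Real.log 2 ≤ L := by
    have : Real.log 8 = 3 * Real.log 2 := by
      rw [show (8 : ℝ) = 2 ^ 3 by norm_num, Real.log_pow]
      norm_num
    rw [← this]
    exact Real.log_le_log (by norm_num) hx
  have hL2 : 2 ≤ L := by linarith
  have hLx : L ≤ x := (Real.log_le_sub_one_of_pos (by linarith)).trans (by linarith)
  set h := x / L with hh
  have hLpos : 0 < L := by linarith
  have hh0 : 0 < h := by positivity
  have hhx : h ≤ x / 2 := by rw [hh]; gcongr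
  have hh1 : 1 ≤ h := by rwa [hh, one_le_div hLpos]
  have hhL : x ^ 2 / L ^ 2 = h ^ 2 := by rw [hh, div_pow]
  obtain ⟨M, hM⟩ := exists_nat_ge (x + x)
  have hM1 : N + 1 ≤ M := by
    have : ((N + 1 : ℕ) : ℝ) ≤ M := by push_cast; change x + 1 ≤ M; linarith
    exact_mod_cast this
  have b0 := hR x (by linarith) M (by linarith)
  have b1 := hR (x + h) (by linarith) M (by linarith)
  have b2 := hR (x - h) (by linarith) M (by linarith)
  have c0 : C * (x ^ 2 / L ^ 2) = C * h ^ 2 := by rw [hhL]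
  have c1 : C * ((x + h) ^ 2 / Real.log (x + h) ^ 2) ≤ 4 * (C * h ^ 2) := by
    have h1 : L ≤ Real.log (x + h) := Real.log_le_log (by linarith) (by linarith)
    calc _ ≤ C * ((2 * x) ^ 2 / L ^ 2) := by gcongr; linarith
      _ = 4 * (C * (x ^ 2 / L ^ 2)) := by ring
      _ = _ := by rw [c0]
  have c2 : C * ((x - h) ^ 2 / Real.log (x - h) ^ 2) ≤ 4 * (C * h ^ 2) := by
    have h1 : L / 2 ≤ Real.log (x - h) := by
      have h2 : L - Real.log 2 ≤ Real.log (x - h) := by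
        rw [hL, ← Real.log_div (by linarith) (by norm_num)]
        exact Real.log_le_log (by linarith) (by linarith)
      linarith
    calc _ ≤ C * (x ^ 2 / (L / 2) ^ 2) := by gcongr <;> linarith
      _ = 4 * (C * (x ^ 2 / L ^ 2)) := by ring
      _ = _ := by rw [c0]
  have d1 := mul_sum_le_sum_max_sub_sum_max hb hM1 hh0.le
  have d2 := sum_max_sub_sum_max_le_mul_sum hb (N := N) (M := M) hh0.le
  rw [c0] at b0
  replace b1 := b1.trans c1
  replace b2 := b2.trans c2
  rw [abs_le] at b0 b1 b2 ⊢
  set B := ∑ n ∈ Finset.range (N + 1), b n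
  have u1 : h * B ≤ h * (c * x + (2 * c + 5 * C) * h) := by
    nlinarith [mul_nonneg hc hh0.le, mul_nonneg (mul_nonneg hc hh0.le) hh0.le]
  have u2 : h * (c * x - (2 * c + 5 * C) * h) ≤ h * B := by
    nlinarith [mul_nonneg hc hh0.le, mul_nonneg (mul_nonneg hc hh0.le) hh0.le,
      mul_nonneg (mul_nonneg hc hh0.le) (sub_nonneg.mpr hh1)]
  have v1 := le_of_mul_le_mul_left u1 hh0
  have v2 := le_of_mul_le_mul_left u2 hh0
  constructor <;> linarith

end Differencing

section PrimesInProgression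

open ArithmeticFunction ArithmeticFunction.vonMangoldt

/-- The prime number theorem in arithmetic progressions, with error term `O(x / log x)`. -/
lemma exists_abs_sum_residueClass_sub_le {q : ℕ} [NeZero q] {a : ZMod q} (ha : IsUnit a) :
    ∃ C : ℝ, ∀ N : ℕ, 8 ≤ N →
      |∑ n ∈ Finset.range (N + 1), residueClass a n - (q.totient : ℝ)⁻¹ * N| ≤
        C * (N / Real.log N) := by
  have hb := residueClass_nonneg a
  have hb0 := residueClass_apply_zero a
  have hM (N : ℕ) : ∑ n ∈ Finset.range (N + 1), residueClass a n ≤ (Real.log 4 + 4) * N := by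
    have h := Chebyshev.psi_le_const_mul_self (x := N) (Nat.cast_nonneg N)
    rw [Chebyshev.psi_eq_sum_Icc, Nat.floor_natCast, ← Nat.range_succ_eq_Icc_zero] at h
    exact (Finset.sum_le_sum fun n _ ↦ residueClass_le a n).trans h
  obtain ⟨C, hC, hK⟩ := exists_norm_deriv_deriv_LFunctionResidueClassAux_le a
  set c : ℝ := (q.totient : ℝ)⁻¹ with hc
  have hc0 : 0 ≤ c := by positivity
  obtain ⟨C', hC'⟩ := exists_log_sq_mul_norm_le (f := fun v ↦ (rieszError (residueClass a) c v : ℂ))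
    (Complex.continuous_ofReal.comp_continuousOn (continuousOn_rieszError _ _))
    (fun v hv ↦ by rw [rieszError_of_one_le hb0 hv.le, Complex.ofReal_zero])
    (isBigO_rieszError hb hc0 hM) (fun s hs ↦ by
      rw [mellin_rieszError hb hb0 hM hs (LSeriesSummable_of_abscissaOfAbsConv_lt_re
          ((abscissaOfAbsConv_residueClass_le_one a).trans_lt (by exact_mod_cast hs))),
        eqOn_LFunctionResidueClassAux ha hs, hc]
      push_cast
      rfl) hK
  have hC'0 : 0 ≤ C' := by simpa using (by positivity : (0 : ℝ) ≤ _).trans (hC' 1 one_pos)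
  simp only [Complex.norm_real, Real.norm_eq_abs] at hC'
  exact ⟨_, fun N hN ↦ abs_sum_sub_le hb hc0 hC'0
    (fun u hu N hN ↦ abs_sum_max_sub_le hC' hu hN) hN⟩

end PrimesInProgression

section MediumPrimes

open ArithmeticFunction ArithmeticFunction.vonMangoldt

/-- The von Mangoldt sum over a residue class exceeds the sum of `log p` over the primes `p ≥ y`
in that class by at most the contributions of prime powers and of primes up to `y`. -/
lemma sum_residueClass_one_four_sub_bounds (N : ℕ) (y : ℝ) :
    0 ≤ ∑ m ∈ Finset.range (N + 1), (residueClass (1 : ZMod 4) m -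
        if m.Prime ∧ y ≤ m ∧ m % 4 = 1 then Real.log m else 0) ∧
      ∑ m ∈ Finset.range (N + 1), (residueClass (1 : ZMod 4) m -
        if m.Prime ∧ y ≤ m ∧ m % 4 = 1 then Real.log m else 0) ≤
        Chebyshev.psi N - Chebyshev.theta N + Chebyshev.theta y := by
  have hmod (m : ℕ) : m ∈ {n : ℕ | (n : ZMod 4) = 1} ↔ m % 4 = 1 := by
    rw [Set.mem_ofPred_eq, ← Nat.cast_one, ZMod.natCast_eq_natCast_iff']
  constructor
  · refine Finset.sum_nonneg fun m _ ↦ ?_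
    split_ifs with h
    · rw [residueClass, Set.indicator_of_mem ((hmod m).mpr h.2.2), vonMangoldt_apply_prime h.1,
        sub_self]
    · simpa using residueClass_nonneg _ m
  · rw [Chebyshev.psi_eq_sum_Icc, Chebyshev.theta_eq_sum_Icc, Nat.floor_natCast,
      ← Nat.range_succ_eq_Icc_zero, Finset.sum_filter, ← Finset.sum_sub_distrib,
      Chebyshev.theta_eq_sum_Icc]
    have h1 : ∑ m ∈ Finset.range (N + 1), (if m.Prime ∧ (m : ℝ) < y then Real.log m else 0) ≤
        ∑ p ∈ (Finset.Icc 0 ⌊y⌋₊).filter Nat.Prime, Real.log p := by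
      rw [← Finset.sum_filter]
      refine Finset.sum_le_sum_of_subset_of_nonneg (fun m hm ↦ ?_)
        fun m _ _ ↦ Real.log_natCast_nonneg m
      simp only [Finset.mem_filter, Finset.mem_Icc, zero_le, true_and] at hm ⊢
      exact ⟨Nat.le_floor hm.2.2.le, hm.2.1⟩
    refine le_trans ?_ (add_le_add_right h1 _)
    rw [← Finset.sum_add_distrib]
    refine Finset.sum_le_sum fun m _ ↦ ?_
    by_cases hp : m.Prime
    · rw [residueClass, Set.indicator_apply]
      simp only [hmod, hp, vonMangoldt_apply_prime hp, true_and, if_true]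
      have := Real.log_natCast_nonneg m
      by_cases hy : y ≤ m
      · by_cases h4 : m % 4 = 1 <;> simp [hy, h4, not_lt.mpr hy]
      · by_cases h4 : m % 4 = 1 <;> simp [hy, h4, not_le.mp hy, this]
    · simp [hp, residueClass_le]

lemma two_mul_sqrt_mul_log_le {y : ℝ} (hy : 1 < y) :
    2 * √y * Real.log y ≤ 32 * (y / Real.log y) := by
  have hy0 : 0 < y := by linarith
  have hlog : 0 < Real.log y := Real.log_pos hy
  have h := Real.log_le_rpow_div hy0.le (ε := 1 / 4) (by norm_num)
  have h4 : (y ^ (1 / 4 : ℝ)) ^ 2 = √y := by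
    rw [Real.sqrt_eq_rpow, ← Real.rpow_natCast, ← Real.rpow_mul hy0.le]
    norm_num
  rw [← mul_div_assoc, le_div_iff₀ hlog]
  calc 2 * √y * Real.log y * Real.log y = 2 * √y * Real.log y ^ 2 := by ring
    _ ≤ 2 * √y * (y ^ (1 / 4 : ℝ) / (1 / 4)) ^ 2 := by gcongr
    _ = 32 * (√y * (y ^ (1 / 4 : ℝ)) ^ 2) := by ring
    _ = 32 * y := by rw [h4, Real.mul_self_sqrt hy0.le]

lemma rpow_two_thirds_le {y : ℝ} (hy : 1 < y) : y ^ ((2 : ℝ) / 3) ≤ 3 * (y / Real.log y) := by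
  have hy0 : 0 < y := by linarith
  have hlog : 0 < Real.log y := Real.log_pos hy
  have h := Real.log_le_rpow_div hy0.le (ε := 1 / 3) (by norm_num)
  rw [← mul_div_assoc, le_div_iff₀ hlog]
  calc _ ≤ y ^ ((2 : ℝ) / 3) * (y ^ (1 / 3 : ℝ) / (1 / 3)) := by gcongr
    _ = 3 * (y ^ ((2 : ℝ) / 3) * y ^ (1 / 3 : ℝ)) := by ring
    _ = 3 * y := by rw [← Real.rpow_add hy0]; norm_num

lemma exists_abs_sum_ite_sub_le :
    ∃ C : ℝ, 0 ≤ C ∧ ∀ n : ℕ, 4 ≤ n →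
      |∑ m ∈ Finset.range (2 * n + 1),
        (if m.Prime ∧ (n : ℝ) ^ ((2 : ℝ) / 3) ≤ m ∧ m % 4 = 1 then Real.log m else 0) - n| ≤
        C * (n / Real.log n) := by
  obtain ⟨C, hC⟩ := exists_abs_sum_residueClass_sub_le (q := 4) (a := 1) isUnit_one
  refine ⟨2 * |C| + 70, by positivity, fun n h4 ↦ ?_⟩
  have hn : (4 : ℝ) ≤ n := by exact_mod_cast h4
  have hlog : 0 < Real.log n := Real.log_pos (by linarith)
  obtain ⟨h1, h2⟩ := sum_residueClass_one_four_sub_bounds (2 * n) ((n : ℝ) ^ ((2 : ℝ) / 3))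
  rw [Finset.sum_sub_distrib] at h1 h2
  have h3 := hC (2 * n) (by omega)
  have htot : Nat.totient 4 = 2 := by decide
  rw [htot] at h3
  push_cast at h2 h3
  rw [inv_mul_cancel_left₀ two_ne_zero] at h3
  have hdiv : 2 * (n : ℝ) / Real.log (2 * n) ≤ 2 * (n / Real.log n) := by
    rw [← mul_div_assoc]
    gcongr
    linarith
  have hpsi := (Chebyshev.psi_sub_theta_le (x := 2 * n) (by linarith)).trans
    (two_mul_sqrt_mul_log_le (by linarith))
  have htheta : Chebyshev.theta ((n : ℝ) ^ ((2 : ℝ) / 3)) ≤ 2 * (3 * (n / Real.log n)) := by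
    refine (Chebyshev.theta_le_log4_mul_x (by positivity)).trans ?_
    gcongr
    · rw [show (4 : ℝ) = 2 ^ 2 by norm_num, Real.log_pow]
      push_cast
      linarith [Real.log_two_lt_d9]
    · exact rpow_two_thirds_le (by linarith)
  have hmain : C * (2 * n / Real.log (2 * n)) ≤ |C| * (2 * (n / Real.log n)) := by
    have : 0 ≤ 2 * (n : ℝ) / Real.log (2 * n) :=
      div_nonneg (by positivity) (Real.log_nonneg (by linarith))
    gcongr
    exact le_abs_self C
  replace h3 := h3.trans hmain
  have hX : 0 ≤ n / Real.log n := by positivity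
  rw [abs_le] at h3 ⊢
  constructor <;> nlinarith

end MediumPrimes

open scoped Classical

/-- There exists `C > 0` such that for all `n ≥ 2`,
`|Σ_{n^{2/3} ≤ p ≤ 2n, p ≡ 1 (mod 4)} log p − n| ≤ C·n/log n`. -/
theorem medium_primes_betastar_contribution :
    ∃ C > 0, ∀ n : ℕ, 2 ≤ n →
      |(∑ p ∈ (Finset.range (2 * n + 1)).filter
            (fun p : ℕ => p.Prime ∧ (n : ℝ) ^ ((2 : ℝ) / 3) ≤ (p : ℝ) ∧ p % 4 = 1),
          Real.log p) - n| ≤ C * n / Real.log n := by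
  obtain ⟨C, hC, h⟩ := exists_abs_sum_ite_sub_le
  set S : ℕ → ℝ := fun n ↦ ∑ p ∈ (Finset.range (2 * n + 1)).filter
      (fun p : ℕ => p.Prime ∧ (n : ℝ) ^ ((2 : ℝ) / 3) ≤ (p : ℝ) ∧ p % 4 = 1), Real.log p with hS
  change ∃ C > 0, ∀ n : ℕ, 2 ≤ n → |S n - n| ≤ C * n / Real.log n
  set D := ∑ m ∈ Finset.range 4, |S m - m| * (Real.log m / m) with hD
  have hterm (m : ℕ) : 0 ≤ |S m - m| * (Real.log m / m) :=
    mul_nonneg (abs_nonneg _) (div_nonneg (Real.log_natCast_nonneg m) (Nat.cast_nonneg m))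
  have hD0 : 0 ≤ D := Finset.sum_nonneg fun m _ ↦ hterm m
  refine ⟨C + D + 1, by positivity, fun n hn ↦ ?_⟩
  have hn' : (2 : ℝ) ≤ n := by exact_mod_cast hn
  have hlog : 0 < Real.log n := Real.log_pos (by linarith)
  rcases lt_or_ge n 4 with h4 | h4
  · rw [le_div_iff₀ hlog]
    have h' := Finset.single_le_sum (fun m _ ↦ hterm m) (Finset.mem_range.mpr h4)
    rw [← mul_div_assoc, div_le_iff₀ (by linarith), ← hD] at h'
    refine h'.trans ?_
    gcongr
    linarith
  · have h' := h n h4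
    rw [← Finset.sum_filter] at h'
    have e : |S n - n| ≤ C * (n / Real.log n) := by
      convert h'
    refine e.trans ?_
    rw [← mul_div_assoc]
    gcongr
    linarith
end
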